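/- arXiv:1905.02539 — 2 statements merged into one kernel-verified Lean document; each statement's English description precedes it below -/
import Mathlib

section
/- Let k ≥ 4 be even, let s ∈ ℂ with 1 < Re(s) < k−1, and let z = (z₁,z₂) ∈ ℍ². Then the function γ ↦ (γ₁z₁)^{−s}·(γ₂z₂)^{−s}·j(γ,z)^{−k·1} on Γ = SL₂(O) is invariant under left multiplication by elements of A, hence descends to the left coset space A\Γ, and the resulting family indexed by A\Γ is absolutely summable (i.e., the series defining the Cohen kernel converges absolutely). -/
open Complex

noncomputable section

namespace HilbertPaper

/-- Möbius action of a real 2×2 matrix on a complex number. -/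
def moebius (g : Matrix (Fin 2) (Fin 2) ℝ) (z : ℂ) : ℂ :=
  (((g 0 0 : ℝ) : ℂ) * z + ((g 0 1 : ℝ) : ℂ)) / (((g 1 0 : ℝ) : ℂ) * z + ((g 1 1 : ℝ) : ℂ))

/-- Automorphy factor `j(g, z) = c z + d`. -/
def jfac (g : Matrix (Fin 2) (Fin 2) ℝ) (z : ℂ) : ℂ :=
  ((g 1 0 : ℝ) : ℂ) * z + ((g 1 1 : ℝ) : ℂ)

variable (F : Type) [Field F] [NumberField F]

/-- The embedding of the ring of integers into ℝ induced by a real embedding σ of F. -/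
def emb (σ : F →+* ℝ) : NumberField.RingOfIntegers F →+* ℝ :=
  σ.comp (algebraMap (NumberField.RingOfIntegers F) F)

/-- An element of F is totally positive when both real embeddings are positive on it. -/
def TotPos (σ₁ σ₂ : F →+* ℝ) (x : F) : Prop := 0 < σ₁ x ∧ 0 < σ₂ x

/-- `F` is a real quadratic field with narrow class number one, whose two real embeddings
are `σ₁ ≠ σ₂`; narrow class number one is expressed as: every nonzero ideal of the ring of
integers has a totally positive generator. -/
def RealQuadNarrowOne (σ₁ σ₂ : F →+* ℝ) : Prop :=
  Module.finrank ℚ F = 2 ∧ σ₁ ≠ σ₂ ∧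
    ∀ I : Ideal (NumberField.RingOfIntegers F), I ≠ ⊥ →
      ∃ a : NumberField.RingOfIntegers F,
        TotPos F σ₁ σ₂ (algebraMap (NumberField.RingOfIntegers F) F a) ∧ I = Ideal.span {a}

/-- Γ = SL₂(O). -/
abbrev SL2O := Matrix.SpecialLinearGroup (Fin 2) (NumberField.RingOfIntegers F)

/-- The real matrix obtained from γ ∈ SL₂(O) by applying σ entrywise. -/
def mat (σ : F →+* ℝ) (γ : SL2O F) : Matrix (Fin 2) (Fin 2) ℝ :=
  (γ : Matrix (Fin 2) (Fin 2) (NumberField.RingOfIntegers F)).map (emb F σ)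

/-- Membership in the subgroup A = {diag(ε, ε⁻¹) : ε a totally positive unit}. -/
def IsInA (σ₁ σ₂ : F →+* ℝ) (a : SL2O F) : Prop :=
  ∃ ε : (NumberField.RingOfIntegers F)ˣ,
    TotPos F σ₁ σ₂ (algebraMap (NumberField.RingOfIntegers F) F (ε : NumberField.RingOfIntegers F)) ∧
    (a : Matrix (Fin 2) (Fin 2) (NumberField.RingOfIntegers F)) =
      !![(ε : NumberField.RingOfIntegers F), 0; 0, ((ε⁻¹ : (NumberField.RingOfIntegers F)ˣ) : NumberField.RingOfIntegers F)]

/-- The relation on Γ whose quotient is the coset space A\Γ. -/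
def ARel (σ₁ σ₂ : F →+* ℝ) (γ γ' : SL2O F) : Prop :=
  ∃ a : SL2O F, IsInA F σ₁ σ₂ a ∧ γ' = a * γ

/-- The summand of the Cohen kernel: (γ₁z₁)^{-s} (γ₂z₂)^{-s} j(γ,z)^{-k·1}. -/
def cohenSummand (σ₁ σ₂ : F →+* ℝ) (k : ℕ) (s : ℂ) (z₁ z₂ : ℂ) (γ : SL2O F) : ℂ :=
  moebius (mat F σ₁ γ) z₁ ^ (-s) * moebius (mat F σ₂ γ) z₂ ^ (-s) *
    (jfac (mat F σ₁ γ) z₁ ^ (-(k : ℤ)) * jfac (mat F σ₂ γ) z₂ ^ (-(k : ℤ)))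


open NumberField in
lemma one_le_abs_emb_mul (σ₁ σ₂ : F →+* ℝ) (hfin : Module.finrank ℚ F = 2) (hne : σ₁ ≠ σ₂)
    {x : 𝓞 F} (hx : x ≠ 0) : 1 ≤ |emb F σ₁ x| * |emb F σ₂ x| := by
  classical
  let e₁ : F →ₐ[ℚ] ℂ := (Complex.ofRealHom.comp σ₁).toRatAlgHom
  let e₂ : F →ₐ[ℚ] ℂ := (Complex.ofRealHom.comp σ₂).toRatAlgHom
  have he : e₁ ≠ e₂ := by
    intro h
    apply hne
    ext y
    have := DFunLike.congr_fun h y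
    exact Complex.ofReal_injective this
  have huniv : (Finset.univ : Finset (F →ₐ[ℚ] ℂ)) = {e₁, e₂} := by
    symm
    rw [← Finset.card_eq_iff_eq_univ, Finset.card_pair he, AlgHom.card, hfin]
  have h := Algebra.norm_eq_prod_embeddings ℚ ℂ (algebraMap (𝓞 F) F x)
  rw [huniv, Finset.prod_pair he] at h
  have h2 : ((Algebra.norm ℤ x : ℤ) : ℝ) = emb F σ₁ x * emb F σ₂ x := by
    apply Complex.ofReal_injective
    push_cast
    have h3 := Algebra.coe_norm_int x
    rw [← h3] at h
    simpa [e₁, e₂, emb] using h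
  rw [← abs_mul, ← h2]
  exact_mod_cast Int.one_le_abs (Algebra.norm_ne_zero_iff.mpr hx)

open NumberField in
lemma abs_emb_unit_mul (σ₁ σ₂ : F →+* ℝ) (hfin : Module.finrank ℚ F = 2) (hne : σ₁ ≠ σ₂)
    (u : (𝓞 F)ˣ) : |emb F σ₁ u| * |emb F σ₂ u| = 1 := by
  have h1 := one_le_abs_emb_mul F σ₁ σ₂ hfin hne u.ne_zero
  have h2 := one_le_abs_emb_mul F σ₁ σ₂ hfin hne u⁻¹.ne_zero
  have h3 : ∀ σ : F →+* ℝ, |emb F σ u| * |emb F σ (u⁻¹ : (𝓞 F)ˣ)| = 1 := by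
    intro σ
    rw [← abs_mul, ← map_mul, Units.mul_inv, map_one, abs_one]
  have h4 : (|emb F σ₁ u| * |emb F σ₂ u|) *
      (|emb F σ₁ (u⁻¹ : (𝓞 F)ˣ)| * |emb F σ₂ (u⁻¹ : (𝓞 F)ˣ)|) = 1 := by
    rw [mul_mul_mul_comm, h3, h3, one_mul]
  nlinarith

open NumberField in
/-- By Dirichlet's unit theorem there is a totally positive unit larger than one at `σ₁`. -/
lemma exists_totPos_unit (σ₁ σ₂ : F →+* ℝ) (hfin : Module.finrank ℚ F = 2) (hne : σ₁ ≠ σ₂) :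
    ∃ ε : (𝓞 F)ˣ, 0 < emb F σ₂ ε ∧ 1 < emb F σ₁ ε := by
  let w₁ := InfinitePlace.mk (Complex.ofRealHom.comp σ₁)
  let w₂ := InfinitePlace.mk (Complex.ofRealHom.comp σ₂)
  have hw : w₂ ≠ w₁ := by
    intro h
    apply hne
    rw [InfinitePlace.mk_eq_iff] at h
    ext y
    apply Complex.ofReal_injective
    rcases h with h | h
    · exact (DFunLike.congr_fun h y).symm
    · have := DFunLike.congr_fun h y
      simpa using this.symm
  obtain ⟨u, hu⟩ := Units.dirichletUnitTheorem.exists_unit F w₁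
  have h1 := hu w₂ hw
  have h2 : w₂ (algebraMap (𝓞 F) F u) = |emb F σ₂ u| := by
    simp [w₂, InfinitePlace.apply, emb]
  rw [h2] at h1
  have h3 := abs_emb_unit_mul F σ₁ σ₂ hfin hne u
  have hpos : 0 < |emb F σ₂ u| := by
    rw [abs_pos]; intro h0; rw [h0] at h3; simp at h3
  have h4 : |emb F σ₂ u| < 1 := by
    by_contra! h
    exact absurd (Real.log_nonneg h) (not_le.mpr h1)
  have h5 : 1 < |emb F σ₁ u| := by nlinarith [abs_nonneg (emb F σ₁ u)]
  refine ⟨u ^ 2, ?_, ?_⟩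
  · push_cast
    rw [map_pow, ← sq_abs]; positivity
  · push_cast
    rw [map_pow, ← sq_abs]; nlinarith

lemma ofReal_mul_cpow_of_pos {r : ℝ} (hr : 0 < r) (w t : ℂ) :
    ((r : ℂ) * w) ^ t = (r : ℂ) ^ t * w ^ t := by
  rcases eq_or_ne t 0 with rfl | ht
  · simp
  rcases eq_or_ne w 0 with rfl | hw
  · simp [Complex.zero_cpow ht]
  have hr0 : (r : ℂ) ≠ 0 := by exact_mod_cast hr.ne'
  rw [Complex.cpow_def_of_ne_zero (mul_ne_zero hr0 hw), Complex.cpow_def_of_ne_zero hr0,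
    Complex.cpow_def_of_ne_zero hw, Complex.log_ofReal_mul hr hw, add_mul, Complex.exp_add,
    Complex.ofReal_log hr.le]

/-- The numerator `a z + b` of the Möbius action. -/
def numer (g : Matrix (Fin 2) (Fin 2) ℝ) (z : ℂ) : ℂ :=
  ((g 0 0 : ℝ) : ℂ) * z + ((g 0 1 : ℝ) : ℂ)

lemma moebius_eq (g : Matrix (Fin 2) (Fin 2) ℝ) (z : ℂ) :
    moebius g z = numer g z / jfac g z := rfl

lemma numer_diag_mul (σ : F →+* ℝ) (ε : (NumberField.RingOfIntegers F)ˣ) (a γ : SL2O F)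
    (ha : (a : Matrix (Fin 2) (Fin 2) (NumberField.RingOfIntegers F)) =
      !![(ε : NumberField.RingOfIntegers F), 0; 0,
        ((ε⁻¹ : (NumberField.RingOfIntegers F)ˣ) : NumberField.RingOfIntegers F)]) (z : ℂ) :
    numer (mat F σ (a * γ)) z = (emb F σ ε : ℝ) * numer (mat F σ γ) z := by
  simp [numer, mat, ha, Matrix.vecMul, dotProduct, Fin.sum_univ_two]
  ring

lemma jfac_diag_mul (σ : F →+* ℝ) (ε : (NumberField.RingOfIntegers F)ˣ) (a γ : SL2O F)
    (ha : (a : Matrix (Fin 2) (Fin 2) (NumberField.RingOfIntegers F)) =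
      !![(ε : NumberField.RingOfIntegers F), 0; 0,
        ((ε⁻¹ : (NumberField.RingOfIntegers F)ˣ) : NumberField.RingOfIntegers F)]) (z : ℂ) :
    jfac (mat F σ (a * γ)) z = ((emb F σ ε : ℝ) : ℂ)⁻¹ * jfac (mat F σ γ) z := by
  have h : emb F σ ((ε⁻¹ : (NumberField.RingOfIntegers F)ˣ) : NumberField.RingOfIntegers F) =
      (emb F σ ε)⁻¹ := by
    apply eq_inv_of_mul_eq_one_left
    rw [← map_mul, Units.inv_mul, map_one]
  simp [jfac, mat, ha, Matrix.vecMul, dotProduct, Fin.sum_univ_two, h]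
  ring

lemma cohenSummand_diag_mul (σ₁ σ₂ : F →+* ℝ) (hfin : Module.finrank ℚ F = 2) (hne : σ₁ ≠ σ₂)
    (k : ℕ) (s z₁ z₂ : ℂ) (a γ : SL2O F) (ha : IsInA F σ₁ σ₂ a) :
    cohenSummand F σ₁ σ₂ k s z₁ z₂ (a * γ) = cohenSummand F σ₁ σ₂ k s z₁ z₂ γ := by
  obtain ⟨ε, ⟨h1, h2⟩, ha⟩ := ha
  change 0 < emb F σ₁ ε at h1
  change 0 < emb F σ₂ ε at h2
  have h12 := abs_emb_unit_mul F σ₁ σ₂ hfin hne ε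
  rw [abs_of_pos h1, abs_of_pos h2] at h12
  unfold cohenSummand
  simp only [moebius_eq, numer_diag_mul F _ ε a γ ha, jfac_diag_mul F _ ε a γ ha]
  set e₁ := emb F σ₁ ε
  set e₂ := emb F σ₂ ε
  have key : ∀ (e : ℝ) (x y : ℂ), (e : ℂ) * x / ((e : ℂ)⁻¹ * y) = ((e ^ 2 : ℝ) : ℂ) * (x / y) := by
    intro e x y
    push_cast
    rw [div_eq_mul_inv, mul_inv, inv_inv]
    ring
  rw [key, key, ofReal_mul_cpow_of_pos (by positivity), ofReal_mul_cpow_of_pos (by positivity),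
    mul_zpow, mul_zpow]
  have hA : ((e₁ ^ 2 : ℝ) : ℂ) ^ (-s) * ((e₂ ^ 2 : ℝ) : ℂ) ^ (-s) = 1 := by
    rw [← Complex.mul_cpow_ofReal_nonneg (by positivity) (by positivity), ← Complex.ofReal_mul,
      ← mul_pow, h12]
    simp
  have hB : ((e₁ : ℂ)⁻¹) ^ (-(k : ℤ)) * ((e₂ : ℂ)⁻¹) ^ (-(k : ℤ)) = 1 := by
    rw [← mul_zpow, ← mul_inv, ← Complex.ofReal_mul, h12]
    simp
  linear_combination (((numer (mat F σ₁ γ) z₁ / jfac (mat F σ₁ γ) z₁) ^ (-s)) *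
    ((numer (mat F σ₂ γ) z₂ / jfac (mat F σ₂ γ) z₂) ^ (-s)) *
    (jfac (mat F σ₁ γ) z₁ ^ (-(k : ℤ))) * (jfac (mat F σ₂ γ) z₂ ^ (-(k : ℤ)))) *
    (hA * (((e₁ : ℂ)⁻¹) ^ (-(k : ℤ)) * ((e₂ : ℂ)⁻¹) ^ (-(k : ℤ))) + hB)

lemma one_add_abs_floor_le (x : ℝ) : 1 + |((⌊x⌋ : ℤ) : ℝ)| ≤ 2 + |x| := by
  have h1 := Int.floor_le x
  have h2 := Int.lt_floor_add_one x
  have h : |((⌊x⌋ : ℤ) : ℝ)| ≤ 1 + |x| := by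
    rw [abs_le]
    constructor <;> linarith [le_abs_self x, neg_abs_le x]
  linarith

lemma abs_mul_im_le_norm (x y : ℝ) {z : ℂ} (hz : 0 < z.im) :
    |x| * z.im ≤ ‖(x : ℂ) * z + (y : ℂ)‖ := by
  have h := Complex.abs_im_le_norm ((x : ℂ) * z + (y : ℂ))
  simpa [abs_mul, abs_of_pos hz] using h

lemma abs_le_norm_add (x y : ℝ) (z : ℂ) :
    |y| ≤ ‖(x : ℂ) * z + (y : ℂ)‖ + |x| * ‖z‖ := by
  have h := norm_sub_le ((x : ℂ) * z + (y : ℂ)) ((x : ℂ) * z)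
  simpa using h

/-- Away from zero, the integer parts of the coefficients of `x z + y` are controlled by its
norm. -/
lemma exists_floor_coeff_bound {z : ℂ} (hz : 0 < z.im) {r : ℝ} (hr : 0 < r) :
    ∃ K : ℝ, 0 < K ∧ ∀ x y : ℝ, r ≤ ‖(x : ℂ) * z + (y : ℂ)‖ →
      1 + |((⌊x⌋ : ℤ) : ℝ)| ≤ K * ‖(x : ℂ) * z + (y : ℂ)‖ ∧
      1 + |((⌊y⌋ : ℤ) : ℝ)| ≤ K * ‖(x : ℂ) * z + (y : ℂ)‖ := by
  refine ⟨2 / r + 1 / z.im + 1 + ‖z‖ / z.im, by positivity, fun x y h => ?_⟩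
  set N := ‖(x : ℂ) * z + (y : ℂ)‖
  have hN : 0 < N := hr.trans_le h
  have h1 : |x| ≤ 1 / z.im * N := by
    rw [one_div_mul_eq_div, le_div_iff₀ hz]
    exact abs_mul_im_le_norm x y hz
  have h2 : |y| ≤ N + 1 / z.im * N * ‖z‖ :=
    (abs_le_norm_add x y z).trans (by gcongr)
  have h3 : 2 ≤ 2 / r * N := by
    rw [div_mul_eq_mul_div, le_div_iff₀ hr]; linarith
  have h4 : 0 ≤ ‖z‖ / z.im * N := by positivity
  have h5 : 0 ≤ 1 / z.im * N := by positivity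
  have h6 : 1 / z.im * N * ‖z‖ = ‖z‖ / z.im * N := by ring
  constructor
  · linarith [one_add_abs_floor_le x]
  · linarith [one_add_abs_floor_le y]

lemma im_jfac_div_numer (g : Matrix (Fin 2) (Fin 2) ℝ) (hg : g.det = 1) (z : ℂ) :
    (jfac g z / numer g z).im = -(z.im / ‖numer g z‖ ^ 2) := by
  rw [Matrix.det_fin_two] at hg
  rw [← Complex.normSq_eq_norm_sq, Complex.div_im]
  simp only [jfac, numer, Complex.add_re, Complex.add_im, Complex.mul_re, Complex.mul_im,
    Complex.ofReal_re, Complex.ofReal_im]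
  rw [← sub_div, ← neg_div]
  congr 1
  linear_combination (-z.im) * hg

lemma exists_floor_re_bound {z : ℂ} (hz : 0 < z.im) {r : ℝ} (hr : 0 < r) :
    ∃ K : ℝ, 0 < K ∧ ∀ g : Matrix (Fin 2) (Fin 2) ℝ, g.det = 1 → r ≤ ‖numer g z‖ →
      1 + |((⌊(jfac g z / numer g z).re⌋ : ℤ) : ℝ)| ≤
        K * ‖jfac g z / numer g z‖ * ‖numer g z‖ ^ 2 := by
  refine ⟨2 / z.im + 1 / r ^ 2, by positivity, fun g hg h => ?_⟩
  have him := Complex.abs_im_le_norm (jfac g z / numer g z)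
  have hre := Complex.abs_re_le_norm (jfac g z / numer g z)
  rw [im_jfac_div_numer g hg, abs_neg, abs_of_nonneg (by positivity)] at him
  set N := ‖numer g z‖
  set W := ‖jfac g z / numer g z‖
  have hN : 0 < N := hr.trans_le h
  have h1 : 2 ≤ 2 / z.im * W * N ^ 2 := by
    rw [div_le_iff₀ (by positivity)] at him
    rw [div_mul_eq_mul_div, div_mul_eq_mul_div, le_div_iff₀ hz]
    linarith
  have h2 : W ≤ 1 / r ^ 2 * W * N ^ 2 := by
    rw [one_div_mul_eq_div, div_mul_eq_mul_div, le_div_iff₀ (by positivity)]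
    gcongr
  have := one_add_abs_floor_le (jfac g z / numer g z).re
  linarith

lemma floor_re_bound_of_one_le {w : ℂ} (hw : 1 ≤ ‖w‖) :
    1 + |((⌊w.re⌋ : ℤ) : ℝ)| ≤ 3 * ‖w‖ := by
  linarith [one_add_abs_floor_le w.re, Complex.abs_re_le_norm w]

lemma rpow_mul_rpow_le {α β p X W c M Q : ℝ} (hc : 0 < c) (hX : c ≤ X) (hW : 1 ≤ W)
    (hp : 0 ≤ p) (hpβ : p ≤ β) (h3p : 3 * p ≤ α + β) (hM : 0 < M) (hQ : 0 < Q)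
    (hQM : Q ≤ M * (X ^ 3 * W)) :
    X ^ (-α) * (X * W) ^ (-β) ≤ c ^ (-(α + β - 3 * p)) * M ^ p * Q ^ (-p) := by
  have hX0 : 0 < X := hc.trans_le hX
  have hW0 : 0 < W := one_pos.trans_le hW
  have h1 : X ^ (-(3 * p)) * W ^ (-p) ≤ M ^ p * Q ^ (-p) := by
    calc X ^ (-(3 * p)) * W ^ (-p) = M ^ p * (M * (X ^ 3 * W)) ^ (-p) := by
          rw [Real.mul_rpow hM.le (by positivity), Real.mul_rpow (by positivity) hW0.le,
            ← mul_assoc, ← Real.rpow_add hM, add_neg_cancel, Real.rpow_zero, one_mul,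
            ← Real.rpow_natCast, ← Real.rpow_mul hX0.le]
          congr 2
          push_cast; ring
      _ ≤ _ := by
          gcongr ?_ * ?_
          exact Real.rpow_le_rpow_of_nonpos hQ hQM (by linarith)
  calc X ^ (-α) * (X * W) ^ (-β)
      = X ^ (-(α + β - 3 * p)) * (X ^ (-(3 * p)) * W ^ (-β)) := by
        rw [Real.mul_rpow hX0.le hW0.le, ← mul_assoc, ← mul_assoc, ← Real.rpow_add hX0,
          ← Real.rpow_add hX0]
        congr 2; ring
    _ ≤ c ^ (-(α + β - 3 * p)) * (X ^ (-(3 * p)) * W ^ (-p)) := by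
        gcongr ?_ * (_ * ?_)
        · exact Real.rpow_le_rpow_of_nonpos hc hX (by linarith)
        · exact Real.rpow_le_rpow_of_exponent_le hW (by linarith)
    _ ≤ c ^ (-(α + β - 3 * p)) * (M ^ p * Q ^ (-p)) := by gcongr
    _ = _ := by ring

/-- The weight on pairs of integers. -/
def pairWeight (p : ℝ) (m : ℤ × ℤ) : ℝ :=
  ((1 + |(m.1 : ℝ)|) * (1 + |(m.2 : ℝ)|)) ^ (-p)

/-- The weight on triples of pairs of integers. -/
def tripleWeight (p : ℝ) (m : (ℤ × ℤ) × (ℤ × ℤ) × (ℤ × ℤ)) : ℝ :=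
  pairWeight p m.1 * (pairWeight p m.2.1 * pairWeight p m.2.2)

lemma pairWeight_nonneg (p : ℝ) (m : ℤ × ℤ) : 0 ≤ pairWeight p m := by
  unfold pairWeight; positivity

lemma tripleWeight_nonneg (p : ℝ) (m : (ℤ × ℤ) × (ℤ × ℤ) × (ℤ × ℤ)) : 0 ≤ tripleWeight p m :=
  mul_nonneg (pairWeight_nonneg p _) (mul_nonneg (pairWeight_nonneg p _) (pairWeight_nonneg p _))

lemma summable_one_add_abs_int_rpow {p : ℝ} (hp : 1 < p) :
    Summable fun n : ℤ => (1 + |(n : ℝ)|) ^ (-p) := by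
  refine Summable.of_norm_bounded_eventually (Real.summable_abs_int_rpow hp) ?_
  filter_upwards [(Set.finite_singleton (0 : ℤ)).compl_mem_cofinite] with n hn
  have hn0 : (0 : ℝ) < |(n : ℝ)| := by
    rw [abs_pos]; exact_mod_cast hn
  rw [Real.norm_of_nonneg (by positivity)]
  exact Real.rpow_le_rpow_of_nonpos hn0 (by linarith) (by linarith)

lemma summable_pairWeight {p : ℝ} (hp : 1 < p) : Summable (pairWeight p) := by
  have h := summable_one_add_abs_int_rpow hp
  refine (h.mul_of_nonneg h (fun n => by positivity) (fun n => by positivity)).congr fun m => ?_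
  rw [pairWeight, Real.mul_rpow (by positivity) (by positivity)]

lemma summable_tripleWeight {p : ℝ} (hp : 1 < p) : Summable (tripleWeight p) := by
  have h := summable_pairWeight hp
  exact h.mul_of_nonneg
    (h.mul_of_nonneg h (pairWeight_nonneg p) (pairWeight_nonneg p)) (pairWeight_nonneg p)
    fun m => mul_nonneg (pairWeight_nonneg p _) (pairWeight_nonneg p _)

/-- The integer parts of the top rows of two real matrices and of the real parts of
`(c z + d) / (a z + b)`. -/
def floorCode (z₁ z₂ : ℂ) (g₁ g₂ : Matrix (Fin 2) (Fin 2) ℝ) :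
    (ℤ × ℤ) × (ℤ × ℤ) × (ℤ × ℤ) :=
  ((⌊g₁ 0 0⌋, ⌊g₂ 0 0⌋), (⌊g₁ 0 1⌋, ⌊g₂ 0 1⌋),
    (⌊(jfac g₁ z₁ / numer g₁ z₁).re⌋, ⌊(jfac g₂ z₂ / numer g₂ z₂).re⌋))

/-- The product of powers of `|a z + b|` and `|c z + d|` that governs the size of the summand of
the Cohen kernel. -/
def absSummand (α β : ℝ) (z₁ z₂ : ℂ) (g₁ g₂ : Matrix (Fin 2) (Fin 2) ℝ) : ℝ :=
  (‖numer g₁ z₁‖ * ‖numer g₂ z₂‖) ^ (-α) * (‖jfac g₁ z₁‖ * ‖jfac g₂ z₂‖) ^ (-β)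

/-- The numerators at the two places are comparable, and their product is at most that of the
denominators. -/
def Balanced (E : ℝ) (z₁ z₂ : ℂ) (g₁ g₂ : Matrix (Fin 2) (Fin 2) ℝ) : Prop :=
  ‖numer g₁ z₁‖ ≤ E * ‖numer g₂ z₂‖ ∧ ‖numer g₂ z₂‖ ≤ E * ‖numer g₁ z₁‖ ∧
    ‖numer g₁ z₁‖ * ‖numer g₂ z₂‖ ≤ ‖jfac g₁ z₁‖ * ‖jfac g₂ z₂‖

lemma exists_absSummand_le {z₁ z₂ : ℂ} (hz₁ : 0 < z₁.im) (hz₂ : 0 < z₂.im) {α β p c E : ℝ}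
    (hc : 0 < c) (hE : 0 < E) (hp : 0 ≤ p) (hpβ : p ≤ β) (h3p : 3 * p ≤ α + β) :
    ∃ C : ℝ, 0 ≤ C ∧ ∀ g₁ g₂ : Matrix (Fin 2) (Fin 2) ℝ, g₁.det = 1 → g₂.det = 1 →
      c ≤ ‖numer g₁ z₁‖ * ‖numer g₂ z₂‖ → Balanced E z₁ z₂ g₁ g₂ →
      absSummand α β z₁ z₂ g₁ g₂ ≤ C * tripleWeight p (floorCode z₁ z₂ g₁ g₂) := by
  have hr : 0 < √(c / E) := Real.sqrt_pos.mpr (by positivity)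
  obtain ⟨A₁, hA₁, hA₁'⟩ := exists_floor_coeff_bound hz₁ hr
  obtain ⟨A₂, hA₂, hA₂'⟩ := exists_floor_coeff_bound hz₂ hr
  obtain ⟨B₁, hB₁, hB₁'⟩ := exists_floor_re_bound hz₁ hr
  obtain ⟨B₂, hB₂, hB₂'⟩ := exists_floor_re_bound hz₂ hr
  set M : ℝ := A₁ ^ 2 * A₂ ^ 2 * (3 * (B₁ + B₂) * E) with hMdef
  have hM : 0 < M := by positivity
  refine ⟨c ^ (-(α + β - 3 * p)) * M ^ p, by positivity, fun g₁ g₂ hd₁ hd₂ hX hbal => ?_⟩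
  obtain ⟨h12, h21, hUV⟩ := hbal
  have hU₁ : √(c / E) ≤ ‖numer g₁ z₁‖ := by
    refine Real.sqrt_le_iff.mpr ⟨norm_nonneg _, ?_⟩
    rw [div_le_iff₀ hE]
    nlinarith [norm_nonneg (numer g₁ z₁)]
  have hU₂ : √(c / E) ≤ ‖numer g₂ z₂‖ := by
    refine Real.sqrt_le_iff.mpr ⟨norm_nonneg _, ?_⟩
    rw [div_le_iff₀ hE]
    nlinarith [norm_nonneg (numer g₂ z₂)]
  obtain ⟨ha₁, hb₁⟩ := hA₁' _ _ hU₁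
  obtain ⟨ha₂, hb₂⟩ := hA₂' _ _ hU₂
  have ht₁ := hB₁' g₁ hd₁ hU₁
  have ht₂ := hB₂' g₂ hd₂ hU₂
  have hs₁ : 1 ≤ ‖jfac g₁ z₁ / numer g₁ z₁‖ → _ := floor_re_bound_of_one_le
  have hs₂ : 1 ≤ ‖jfac g₂ z₂ / numer g₂ z₂‖ → _ := floor_re_bound_of_one_le
  change _ ≤ A₁ * ‖numer g₁ z₁‖ at ha₁ hb₁
  change _ ≤ A₂ * ‖numer g₂ z₂‖ at ha₂ hb₂
  have hV₁ : ‖jfac g₁ z₁‖ = ‖numer g₁ z₁‖ * ‖jfac g₁ z₁ / numer g₁ z₁‖ := by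
    rw [norm_div, mul_div_cancel₀ _ (hr.trans_le hU₁).ne']
  have hV₂ : ‖jfac g₂ z₂‖ = ‖numer g₂ z₂‖ * ‖jfac g₂ z₂ / numer g₂ z₂‖ := by
    rw [norm_div, mul_div_cancel₀ _ (hr.trans_le hU₂).ne']
  rw [hV₁, hV₂] at hUV
  unfold absSummand tripleWeight pairWeight floorCode
  rw [hV₁, hV₂]
  dsimp only
  rw [← Real.mul_rpow (by positivity) (by positivity),
    ← Real.mul_rpow (by positivity) (by positivity), mul_mul_mul_comm ‖numer g₁ z₁‖]
  set U₁ := ‖numer g₁ z₁‖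
  set U₂ := ‖numer g₂ z₂‖
  set W₁ := ‖jfac g₁ z₁ / numer g₁ z₁‖
  set W₂ := ‖jfac g₂ z₂ / numer g₂ z₂‖
  set T₁ := 1 + |((⌊(jfac g₁ z₁ / numer g₁ z₁).re⌋ : ℤ) : ℝ)|
  set T₂ := 1 + |((⌊(jfac g₂ z₂ / numer g₂ z₂).re⌋ : ℤ) : ℝ)|
  have hU₁0 : 0 < U₁ := hr.trans_le hU₁
  have hU₂0 : 0 < U₂ := hr.trans_le hU₂
  have hW₁0 : 0 ≤ W₁ := norm_nonneg _
  have hW₂0 : 0 ≤ W₂ := norm_nonneg _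
  have hT₁0 : 0 < T₁ := by positivity
  have hT₂0 : 0 < T₂ := by positivity
  have hW : 1 ≤ W₁ * W₂ := by
    have : 0 < U₁ * U₂ := by positivity
    by_contra! h
    nlinarith
  have hT : T₁ * T₂ ≤ 3 * (B₁ + B₂) * E * ((U₁ * U₂) * (W₁ * W₂)) := by
    rcases le_total 1 W₁ with h | h
    · calc T₁ * T₂ ≤ (3 * W₁) * (B₂ * W₂ * U₂ ^ 2) := by gcongr; exact hs₁ h
        _ = 3 * B₂ * (W₁ * W₂ * U₂) * U₂ := by ring
        _ ≤ 3 * (B₁ + B₂) * (W₁ * W₂ * U₂) * (E * U₁) := by gcongr; linarith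
        _ = _ := by ring
    · have h' : 1 ≤ W₂ := by nlinarith
      calc T₁ * T₂ ≤ (B₁ * W₁ * U₁ ^ 2) * (3 * W₂) := by gcongr; exact hs₂ h'
        _ = 3 * B₁ * (W₁ * W₂ * U₁) * U₁ := by ring
        _ ≤ 3 * (B₁ + B₂) * (W₁ * W₂ * U₁) * (E * U₂) := by gcongr; linarith
        _ = _ := by ring
  refine rpow_mul_rpow_le hc hX hW hp hpβ h3p hM (by positivity) ?_
  calc _ ≤ (A₁ * U₁ * (A₂ * U₂)) * ((A₁ * U₁ * (A₂ * U₂)) *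
        (3 * (B₁ + B₂) * E * ((U₁ * U₂) * (W₁ * W₂)))) := by gcongr
    _ = _ := by rw [hMdef]; ring

lemma det_mat (σ : F →+* ℝ) (γ : SL2O F) : (mat F σ γ).det = 1 := by
  have h := congrArg (emb F σ) γ.det_coe
  rw [map_one, RingHom.map_det] at h
  exact h

/-- A nonzero pair `(a, b)` of integers has `|N (a z + b)|` bounded below. -/
lemma le_norm_mul_norm (σ₁ σ₂ : F →+* ℝ) (hfin : Module.finrank ℚ F = 2) (hne : σ₁ ≠ σ₂)
    {z₁ z₂ : ℂ} (hz₁ : 0 < z₁.im) (hz₂ : 0 < z₂.im) {a b : NumberField.RingOfIntegers F}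
    (hab : a ≠ 0 ∨ b ≠ 0) :
    min 1 (z₁.im * z₂.im) ≤ ‖((emb F σ₁ a : ℝ) : ℂ) * z₁ + ((emb F σ₁ b : ℝ) : ℂ)‖ *
      ‖((emb F σ₂ a : ℝ) : ℂ) * z₂ + ((emb F σ₂ b : ℝ) : ℂ)‖ := by
  by_cases ha : a = 0
  · have hb := hab.resolve_left (not_not.mpr ha)
    refine (min_le_left _ _).trans ?_
    simpa [ha] using one_le_abs_emb_mul F σ₁ σ₂ hfin hne hb
  · refine (min_le_right _ _).trans ?_
    calc z₁.im * z₂.im = 1 * (z₁.im * z₂.im) := (one_mul _).symm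
      _ ≤ (|emb F σ₁ a| * |emb F σ₂ a|) * (z₁.im * z₂.im) := by
          gcongr
          exact one_le_abs_emb_mul F σ₁ σ₂ hfin hne ha
      _ = (|emb F σ₁ a| * z₁.im) * (|emb F σ₂ a| * z₂.im) := by ring
      _ ≤ _ := by
          gcongr
          · exact abs_mul_im_le_norm _ _ hz₁
          · exact abs_mul_im_le_norm _ _ hz₂

lemma le_numer_mul_numer (σ₁ σ₂ : F →+* ℝ) (hfin : Module.finrank ℚ F = 2) (hne : σ₁ ≠ σ₂)
    {z₁ z₂ : ℂ} (hz₁ : 0 < z₁.im) (hz₂ : 0 < z₂.im) (γ : SL2O F) :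
    min 1 (z₁.im * z₂.im) ≤ ‖numer (mat F σ₁ γ) z₁‖ * ‖numer (mat F σ₂ γ) z₂‖ := by
  refine le_norm_mul_norm F σ₁ σ₂ hfin hne hz₁ hz₂ (a := γ.1 0 0) (b := γ.1 0 1) ?_
  by_contra! h
  have := γ.det_coe
  rw [Matrix.det_fin_two] at this
  simp [h.1, h.2] at this

lemma le_jfac_mul_jfac (σ₁ σ₂ : F →+* ℝ) (hfin : Module.finrank ℚ F = 2) (hne : σ₁ ≠ σ₂)
    {z₁ z₂ : ℂ} (hz₁ : 0 < z₁.im) (hz₂ : 0 < z₂.im) (γ : SL2O F) :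
    min 1 (z₁.im * z₂.im) ≤ ‖jfac (mat F σ₁ γ) z₁‖ * ‖jfac (mat F σ₂ γ) z₂‖ := by
  refine le_norm_mul_norm F σ₁ σ₂ hfin hne hz₁ hz₂ (a := γ.1 1 0) (b := γ.1 1 1) ?_
  by_contra! h
  have := γ.det_coe
  rw [Matrix.det_fin_two] at this
  simp [h.1, h.2] at this

lemma eq_zero_of_abs_emb_lt_one (σ₁ σ₂ : F →+* ℝ) (hfin : Module.finrank ℚ F = 2) (hne : σ₁ ≠ σ₂)
    {x : NumberField.RingOfIntegers F} (h₁ : |emb F σ₁ x| < 1) (h₂ : |emb F σ₂ x| < 1) :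
    x = 0 := by
  by_contra hx
  have := one_le_abs_emb_mul F σ₁ σ₂ hfin hne hx
  nlinarith [abs_nonneg (emb F σ₁ x), abs_nonneg (emb F σ₂ x)]

lemma floorCode_injective (σ₁ σ₂ : F →+* ℝ) (hfin : Module.finrank ℚ F = 2) (hne : σ₁ ≠ σ₂)
    {z₁ z₂ : ℂ} (hz₁ : 0 < z₁.im) (hz₂ : 0 < z₂.im) :
    Function.Injective fun γ : SL2O F => floorCode z₁ z₂ (mat F σ₁ γ) (mat F σ₂ γ) := by
  intro γ γ' h
  simp only [floorCode, Prod.mk.injEq] at h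
  obtain ⟨⟨ha₁, ha₂⟩, ⟨hb₁, hb₂⟩, ht₁, ht₂⟩ := h
  have hdiff : ∀ {x y : NumberField.RingOfIntegers F}, ⌊emb F σ₁ x⌋ = ⌊emb F σ₁ y⌋ →
      ⌊emb F σ₂ x⌋ = ⌊emb F σ₂ y⌋ → x = y := by
    intro x y h₁ h₂
    rw [← sub_eq_zero]
    apply eq_zero_of_abs_emb_lt_one F σ₁ σ₂ hfin hne <;> rw [map_sub] <;>
      exact Int.abs_sub_lt_one_of_floor_eq_floor (by assumption)
  have ha : γ.1 0 0 = γ'.1 0 0 := hdiff ha₁ ha₂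
  have hb : γ.1 0 1 = γ'.1 0 1 := hdiff hb₁ hb₂
  have hd := γ.det_coe
  have hd' := γ'.det_coe
  rw [Matrix.det_fin_two] at hd hd'
  rw [← ha, ← hb] at hd'
  set t := (γ.1 1 0 - γ'.1 1 0) * γ.1 1 1 - (γ.1 1 1 - γ'.1 1 1) * γ.1 1 0 with ht
  have hc : γ.1 1 0 = γ'.1 1 0 + t * γ.1 0 0 := by
    rw [ht]
    linear_combination γ'.1 1 0 * hd - γ.1 1 0 * hd'
  have hd2 : γ.1 1 1 = γ'.1 1 1 + t * γ.1 0 1 := by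
    rw [ht]
    linear_combination γ'.1 1 1 * hd - γ.1 1 1 * hd'
  have hpos := fun γ => (lt_min one_pos (mul_pos hz₁ hz₂)).trans_le
    (le_numer_mul_numer F σ₁ σ₂ hfin hne hz₁ hz₂ γ)
  have hre : ∀ (σ : F →+* ℝ) (z : ℂ), numer (mat F σ γ) z ≠ 0 →
      (jfac (mat F σ γ) z / numer (mat F σ γ) z).re -
        (jfac (mat F σ γ') z / numer (mat F σ γ') z).re = emb F σ t := by
    intro σ z hn
    have h1 : numer (mat F σ γ') z = numer (mat F σ γ) z := by
      simp only [numer, mat, Matrix.map_apply]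
      rw [ha, hb]
    have h2 : jfac (mat F σ γ) z =
        jfac (mat F σ γ') z + ((emb F σ t : ℝ) : ℂ) * numer (mat F σ γ) z := by
      simp only [jfac, numer, mat, Matrix.map_apply]
      rw [hc, hd2]
      simp only [map_add, map_mul, Complex.ofReal_add, Complex.ofReal_mul]
      ring
    rw [h1, h2, ← Complex.sub_re, ← sub_div, add_sub_cancel_left, mul_div_cancel_right₀ _ hn,
      Complex.ofReal_re]
  have hn₁ : numer (mat F σ₁ γ) z₁ ≠ 0 :=
    norm_pos_iff.mp (pos_of_mul_pos_left (hpos γ) (norm_nonneg _))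
  have hn₂ : numer (mat F σ₂ γ) z₂ ≠ 0 :=
    norm_pos_iff.mp (pos_of_mul_pos_right (hpos γ) (norm_nonneg _))
  have ht0 : t = 0 := by
    apply eq_zero_of_abs_emb_lt_one F σ₁ σ₂ hfin hne
    · rw [← hre σ₁ z₁ hn₁]
      exact Int.abs_sub_lt_one_of_floor_eq_floor ht₁
    · rw [← hre σ₂ z₂ hn₂]
      exact Int.abs_sub_lt_one_of_floor_eq_floor ht₂
  rw [ht0, zero_mul, add_zero] at hc hd2
  ext i j
  fin_cases i <;> fin_cases j
  exacts [congrArg _ ha, congrArg _ hb, congrArg _ hc, congrArg _ hd2]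

lemma norm_cpow_neg_le (w s : ℂ) :
    ‖w ^ (-s)‖ ≤ ‖w‖ ^ (-s.re) * Real.exp (Real.pi * |s.im|) := by
  refine (Complex.norm_cpow_le w (-s)).trans ?_
  rw [Complex.neg_re, div_eq_mul_inv, ← Real.exp_neg]
  gcongr
  rw [Complex.neg_im, mul_neg, neg_neg]
  refine (le_abs_self _).trans ?_
  rw [abs_mul]
  gcongr
  exact Complex.abs_arg_le_pi w

lemma norm_cohenSummand_le (σ₁ σ₂ : F →+* ℝ) (k : ℕ) (s z₁ z₂ : ℂ) (γ : SL2O F)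
    (h₁ : 0 < ‖jfac (mat F σ₁ γ) z₁‖) (h₂ : 0 < ‖jfac (mat F σ₂ γ) z₂‖) :
    ‖cohenSummand F σ₁ σ₂ k s z₁ z₂ γ‖ ≤ Real.exp (Real.pi * |s.im|) ^ 2 *
      absSummand s.re (k - s.re) z₁ z₂ (mat F σ₁ γ) (mat F σ₂ γ) := by
  unfold cohenSummand absSummand
  have hw₁ := norm_cpow_neg_le (moebius (mat F σ₁ γ) z₁) s
  have hw₂ := norm_cpow_neg_le (moebius (mat F σ₂ γ) z₂) s
  rw [moebius_eq, norm_div] at hw₁ hw₂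
  rw [norm_mul, norm_mul, norm_mul, norm_zpow, norm_zpow, moebius_eq, moebius_eq]
  set V₁ := ‖jfac (mat F σ₁ γ) z₁‖
  set V₂ := ‖jfac (mat F σ₂ γ) z₂‖
  set U₁ := ‖numer (mat F σ₁ γ) z₁‖
  set U₂ := ‖numer (mat F σ₂ γ) z₂‖
  have hU₁ : 0 ≤ U₁ := norm_nonneg _
  have hU₂ : 0 ≤ U₂ := norm_nonneg _
  have key : ∀ U V : ℝ, 0 ≤ U → 0 < V →
      (U / V) ^ (-s.re) * V ^ (-(k : ℤ)) = U ^ (-s.re) * V ^ (-(k - s.re)) := by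
    intro U V hU hV
    rw [Real.div_rpow hU hV.le, div_eq_mul_inv, ← Real.rpow_neg hV.le, mul_assoc,
      ← Real.rpow_intCast, ← Real.rpow_add hV]
    congr 2
    push_cast; ring
  calc _ ≤ ((U₁ / V₁) ^ (-s.re) * Real.exp (Real.pi * |s.im|)) *
        ((U₂ / V₂) ^ (-s.re) * Real.exp (Real.pi * |s.im|)) *
        (V₁ ^ (-(k : ℤ)) * V₂ ^ (-(k : ℤ))) := by gcongr
    _ = Real.exp (Real.pi * |s.im|) ^ 2 * (((U₁ / V₁) ^ (-s.re) * V₁ ^ (-(k : ℤ))) *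
        ((U₂ / V₂) ^ (-s.re) * V₂ ^ (-(k : ℤ)))) := by ring
    _ = _ := by
        rw [key _ _ hU₁ h₁, key _ _ hU₂ h₂, Real.mul_rpow hU₁ hU₂, Real.mul_rpow h₁.le h₂.le]
        ring

lemma absSummand_nonneg (α β : ℝ) (z₁ z₂ : ℂ) (g₁ g₂ : Matrix (Fin 2) (Fin 2) ℝ) :
    0 ≤ absSummand α β z₁ z₂ g₁ g₂ := by
  unfold absSummand; positivity

lemma summable_indicator_balanced (σ₁ σ₂ : F →+* ℝ) (hfin : Module.finrank ℚ F = 2)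
    (hne : σ₁ ≠ σ₂) {z₁ z₂ : ℂ} (hz₁ : 0 < z₁.im) (hz₂ : 0 < z₂.im) {α β E : ℝ}
    (hβ : 1 < β) (hαβ : 4 ≤ α + β) (hE : 0 < E) :
    Summable ({γ : SL2O F | Balanced E z₁ z₂ (mat F σ₁ γ) (mat F σ₂ γ)}.indicator
      fun γ => absSummand α β z₁ z₂ (mat F σ₁ γ) (mat F σ₂ γ)) := by
  have hp1 : 1 < min β (5 / 4) := lt_min hβ (by norm_num)
  have hp2 : min β (5 / 4) ≤ 5 / 4 := min_le_right _ _
  obtain ⟨C, hC, hbound⟩ := exists_absSummand_le hz₁ hz₂ (α := α) (β := β)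
    (p := min β (5 / 4)) (c := min 1 (z₁.im * z₂.im)) (lt_min one_pos (mul_pos hz₁ hz₂)) hE
    (by linarith) (min_le_left _ _) (by linarith)
  refine Summable.of_nonneg_of_le
    (fun γ => Set.indicator_nonneg (fun γ _ => absSummand_nonneg _ _ _ _ _ _) γ) (fun γ => ?_)
    (((summable_tripleWeight hp1).comp_injective
      (floorCode_injective F σ₁ σ₂ hfin hne hz₁ hz₂)).mul_left C)
  by_cases hγ : γ ∈ {γ : SL2O F | Balanced E z₁ z₂ (mat F σ₁ γ) (mat F σ₂ γ)}
  · rw [Set.indicator_of_mem hγ]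
    exact hbound _ _ (det_mat F σ₁ γ) (det_mat F σ₂ γ)
      (le_numer_mul_numer F σ₁ σ₂ hfin hne hz₁ hz₂ γ) hγ
  · rw [Set.indicator_of_notMem hγ]
    exact mul_nonneg hC (tripleWeight_nonneg _ _)

/-- The matrix exchanging the rows up to sign. -/
def rowSwap : SL2O F := ⟨!![0, 1; -1, 0], by simp⟩

lemma coe_rowSwap : (rowSwap F : Matrix (Fin 2) (Fin 2) (NumberField.RingOfIntegers F)) =
    !![0, 1; -1, 0] := rfl

lemma numer_rowSwap_mul (σ : F →+* ℝ) (γ : SL2O F) (z : ℂ) :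
    numer (mat F σ (rowSwap F * γ)) z = jfac (mat F σ γ) z := by
  simp [numer, jfac, mat, coe_rowSwap, Matrix.vecMul, dotProduct, Fin.sum_univ_two]

lemma norm_jfac_rowSwap_mul (σ : F →+* ℝ) (γ : SL2O F) (z : ℂ) :
    ‖jfac (mat F σ (rowSwap F * γ)) z‖ = ‖numer (mat F σ γ) z‖ := by
  rw [← norm_neg]
  congr 1
  simp [numer, jfac, mat, coe_rowSwap, Matrix.vecMul, dotProduct, Fin.sum_univ_two]
  ring

lemma absSummand_rowSwap_mul (σ₁ σ₂ : F →+* ℝ) (α β : ℝ) (z₁ z₂ : ℂ) (γ : SL2O F) :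
    absSummand β α z₁ z₂ (mat F σ₁ (rowSwap F * γ)) (mat F σ₂ (rowSwap F * γ)) =
      absSummand α β z₁ z₂ (mat F σ₁ γ) (mat F σ₂ γ) := by
  simp only [absSummand, numer_rowSwap_mul, norm_jfac_rowSwap_mul]
  ring

lemma exists_zpow_comparable {r x y : ℝ} (hr : 1 < r) (hx : 0 < x) (hy : 0 < y) :
    ∃ n : ℤ, r ^ n * x ≤ r ^ 2 * ((r ^ n)⁻¹ * y) ∧ (r ^ n)⁻¹ * y ≤ r ^ 2 * (r ^ n * x) := by
  have hr2 : 1 < r ^ 2 := one_lt_pow₀ hr two_ne_zero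
  obtain ⟨n, h1, h2⟩ := exists_mem_Ico_zpow (div_pos hy hx) hr2
  have hr0 : 0 < r := one_pos.trans hr
  have hq : 0 < r ^ n := zpow_pos hr0 n
  have hsq : (r ^ 2) ^ n = r ^ n * r ^ n := by rw [sq, mul_zpow]
  rw [zpow_add_one₀ (by positivity), div_lt_iff₀ hx, hsq] at h2
  rw [le_div_iff₀ hx, hsq] at h1
  refine ⟨n, ?_, ?_⟩
  · calc r ^ n * x = (r ^ n)⁻¹ * (r ^ n * r ^ n * x) := by field_simp
      _ ≤ (r ^ n)⁻¹ * y := by gcongr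
      _ ≤ r ^ 2 * ((r ^ n)⁻¹ * y) := le_mul_of_one_le_left (by positivity) hr2.le
  · rw [inv_mul_le_iff₀ hq]
    linarith

lemma emb_unit_zpow (σ : F →+* ℝ) (ε : (NumberField.RingOfIntegers F)ˣ) (n : ℤ) :
    emb F σ ((ε ^ n : (NumberField.RingOfIntegers F)ˣ) : NumberField.RingOfIntegers F) =
      emb F σ ε ^ n := by
  have h := congrArg Units.val (map_zpow (Units.map (emb F σ : _ →* ℝ)) ε n)
  rwa [Units.val_zpow_eq_zpow_val] at h

/-- Every coset of the diagonal subgroup has a representative that is balanced, possibly after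
exchanging its rows. -/
lemma exists_balanced_rep (σ₁ σ₂ : F →+* ℝ) (hfin : Module.finrank ℚ F = 2) (hne : σ₁ ≠ σ₂)
    {z₁ z₂ : ℂ} (hz₁ : 0 < z₁.im) (hz₂ : 0 < z₂.im) :
    ∃ E : ℝ, 0 < E ∧ ∀ γ : SL2O F, ∃ a : SL2O F, IsInA F σ₁ σ₂ a ∧
      (Balanced E z₁ z₂ (mat F σ₁ (a * γ)) (mat F σ₂ (a * γ)) ∨
        Balanced E z₁ z₂ (mat F σ₁ (rowSwap F * (a * γ))) (mat F σ₂ (rowSwap F * (a * γ)))) := by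
  obtain ⟨ε, h₂, h₁⟩ := exists_totPos_unit F σ₁ σ₂ hfin hne
  have h12 := abs_emb_unit_mul F σ₁ σ₂ hfin hne ε
  rw [abs_of_pos (one_pos.trans h₁), abs_of_pos h₂] at h12
  have hr0 : 0 < emb F σ₁ ε := one_pos.trans h₁
  have hinv : emb F σ₂ ε = (emb F σ₁ ε)⁻¹ := eq_inv_of_mul_eq_one_right h12
  refine ⟨emb F σ₁ ε ^ 2, by positivity, fun γ => ?_⟩
  have hmin : 0 < min 1 (z₁.im * z₂.im) := lt_min one_pos (mul_pos hz₁ hz₂)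
  have hU := hmin.trans_le (le_numer_mul_numer F σ₁ σ₂ hfin hne hz₁ hz₂ γ)
  have hV := hmin.trans_le (le_jfac_mul_jfac F σ₁ σ₂ hfin hne hz₁ hz₂ γ)
  let diag : ℤ → SL2O F := fun n =>
    ⟨!![((ε ^ n : (NumberField.RingOfIntegers F)ˣ) : NumberField.RingOfIntegers F), 0; 0,
      (((ε ^ n)⁻¹ : (NumberField.RingOfIntegers F)ˣ) : NumberField.RingOfIntegers F)], by
      rw [Matrix.det_fin_two_of, Units.mul_inv, mul_zero, sub_zero]⟩
  have hmem : ∀ n, IsInA F σ₁ σ₂ (diag n) := by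
    intro n
    refine ⟨ε ^ n, ⟨?_, ?_⟩, rfl⟩
    · change 0 < emb F σ₁ _
      rw [emb_unit_zpow]; positivity
    · change 0 < emb F σ₂ _
      rw [emb_unit_zpow]; positivity
  have hpos : ∀ n : ℤ, 0 < emb F σ₁ ε ^ n := fun n => zpow_pos hr0 n
  have hn₁ : ∀ n, ‖numer (mat F σ₁ (diag n * γ)) z₁‖ =
      emb F σ₁ ε ^ n * ‖numer (mat F σ₁ γ) z₁‖ := by
    intro n
    rw [numer_diag_mul F σ₁ (ε ^ n) _ _ rfl, emb_unit_zpow, norm_mul,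
      Complex.norm_of_nonneg (hpos n).le]
  have hn₂ : ∀ n, ‖numer (mat F σ₂ (diag n * γ)) z₂‖ =
      (emb F σ₁ ε ^ n)⁻¹ * ‖numer (mat F σ₂ γ) z₂‖ := by
    intro n
    rw [numer_diag_mul F σ₂ (ε ^ n) _ _ rfl, emb_unit_zpow, norm_mul, hinv, inv_zpow,
      Complex.norm_of_nonneg (inv_pos.mpr (hpos n)).le]
  have hj₁ : ∀ n, ‖jfac (mat F σ₁ (diag n * γ)) z₁‖ =
      (emb F σ₁ ε ^ n)⁻¹ * ‖jfac (mat F σ₁ γ) z₁‖ := by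
    intro n
    rw [jfac_diag_mul F σ₁ (ε ^ n) _ _ rfl, emb_unit_zpow, norm_mul, norm_inv,
      Complex.norm_of_nonneg (hpos n).le]
  have hj₂ : ∀ n, ‖jfac (mat F σ₂ (diag n * γ)) z₂‖ =
      emb F σ₁ ε ^ n * ‖jfac (mat F σ₂ γ) z₂‖ := by
    intro n
    rw [jfac_diag_mul F σ₂ (ε ^ n) _ _ rfl, emb_unit_zpow, norm_mul, hinv, inv_zpow, norm_inv,
      Complex.norm_of_nonneg (inv_pos.mpr (hpos n)).le, inv_inv]
  have hprod : ∀ (n : ℤ) (x y : ℝ), emb F σ₁ ε ^ n * x * ((emb F σ₁ ε ^ n)⁻¹ * y) = x * y := by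
    intro n x y
    have := (hpos n).ne'
    field_simp
  have hprod' : ∀ (n : ℤ) (x y : ℝ), (emb F σ₁ ε ^ n)⁻¹ * x * (emb F σ₁ ε ^ n * y) = x * y := by
    intro n x y
    have := (hpos n).ne'
    field_simp
  rcases le_total (‖numer (mat F σ₁ γ) z₁‖ * ‖numer (mat F σ₂ γ) z₂‖)
    (‖jfac (mat F σ₁ γ) z₁‖ * ‖jfac (mat F σ₂ γ) z₂‖) with h | h
  · obtain ⟨n, hn⟩ := exists_zpow_comparable h₁ (pos_of_mul_pos_left hU (norm_nonneg _))
      (pos_of_mul_pos_right hU (norm_nonneg _))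
    refine ⟨diag n, hmem n, Or.inl ?_⟩
    unfold Balanced
    rw [hn₁, hn₂, hj₁, hj₂, hprod, hprod']
    exact ⟨hn.1, hn.2, h⟩
  · obtain ⟨n, hn⟩ := exists_zpow_comparable h₁ (pos_of_mul_pos_right hV (norm_nonneg _))
      (pos_of_mul_pos_left hV (norm_nonneg _))
    refine ⟨diag n, hmem n, Or.inr ?_⟩
    unfold Balanced
    rw [numer_rowSwap_mul, numer_rowSwap_mul, norm_jfac_rowSwap_mul, norm_jfac_rowSwap_mul,
      hn₁, hn₂, hj₁, hj₂, hprod, hprod']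
    exact ⟨hn.2, hn.1, h⟩

/-- For even `k ≥ 4`, `1 < Re s < k - 1` and `z = (z₁, z₂) ∈ ℍ²`, the summand
of the Cohen kernel is invariant under left multiplication by elements of
`A = {diag(ε,ε⁻¹) : ε ∈ O₊ˣ}`, hence descends to `A\Γ`, and every function on the coset space
`A\Γ` induced by it is (absolutely) summable. -/
theorem statement0 (σ₁ σ₂ : F →+* ℝ) (hF : RealQuadNarrowOne F σ₁ σ₂)
    (k : ℕ) (hkeven : Even k) (hk4 : 4 ≤ k)
    (s : ℂ) (hs1 : 1 < s.re) (hs2 : s.re < (k : ℝ) - 1)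
    (z₁ z₂ : ℂ) (hz₁ : 0 < z₁.im) (hz₂ : 0 < z₂.im) :
    (∀ a γ : SL2O F, IsInA F σ₁ σ₂ a →
        cohenSummand F σ₁ σ₂ k s z₁ z₂ (a * γ) = cohenSummand F σ₁ σ₂ k s z₁ z₂ γ) ∧
    (∀ f : Quot (ARel F σ₁ σ₂) → ℂ,
        (∀ γ : SL2O F, f (Quot.mk _ γ) = cohenSummand F σ₁ σ₂ k s z₁ z₂ γ) →
        Summable f) := by
  obtain ⟨hfin, hne, -⟩ := hF
  refine ⟨fun a γ ha => cohenSummand_diag_mul F σ₁ σ₂ hfin hne k s z₁ z₂ a γ ha, fun f hf => ?_⟩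
  obtain ⟨E, hE, hrep⟩ := exists_balanced_rep F σ₁ σ₂ hfin hne hz₁ hz₂
  have hk : (4 : ℝ) ≤ k := by exact_mod_cast hk4
  have hS := summable_indicator_balanced F σ₁ σ₂ hfin hne hz₁ hz₂ (α := s.re)
    (β := k - s.re) (by linarith) (by linarith) hE
  have hS' := (Equiv.mulLeft (rowSwap F)).summable_iff.mpr
    (summable_indicator_balanced F σ₁ σ₂ hfin hne hz₁ hz₂ (α := k - s.re)
      (β := s.re) (by linarith) (by linarith) hE)
  choose a ha hbal using hrep
  let rep : Quot (ARel F σ₁ σ₂) → SL2O F := fun q => a q.out * q.out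
  have hmk : ∀ q, Quot.mk (ARel F σ₁ σ₂) (rep q) = q := fun q =>
    (Quot.sound ⟨a q.out, ha q.out, rfl⟩).symm.trans q.out_eq
  have hinj : Function.Injective rep := Function.LeftInverse.injective hmk
  refine Summable.of_norm_bounded
    (((hS.add hS').comp_injective hinj).mul_left (Real.exp (Real.pi * |s.im|) ^ 2)) fun q => ?_
  have hpos := (lt_min one_pos (mul_pos hz₁ hz₂)).trans_le
    (le_jfac_mul_jfac F σ₁ σ₂ hfin hne hz₁ hz₂ (rep q))
  rw [← hmk q, hf, hmk q]
  refine (norm_cohenSummand_le F σ₁ σ₂ k s z₁ z₂ (rep q)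
    (pos_of_mul_pos_left hpos (norm_nonneg _)) (pos_of_mul_pos_right hpos (norm_nonneg _))).trans
    (mul_le_mul_of_nonneg_left ?_ (by positivity))
  simp only [Function.comp_apply, Equiv.coe_mulLeft]
  rcases hbal q.out with h | h
  · refine le_add_of_le_of_nonneg (le_of_eq ?_)
      (Set.indicator_nonneg (fun γ _ => absSummand_nonneg _ _ _ _ _ _) _)
    rw [Set.indicator_of_mem]
    exact h
  · refine le_add_of_nonneg_of_le
      (Set.indicator_nonneg (fun γ _ => absSummand_nonneg _ _ _ _ _ _) _) (le_of_eq ?_)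
    rw [Set.indicator_of_mem, absSummand_rowSwap_mul]
    exact h

end HilbertPaper
end
end

section
/- Multi-variable Lipschitz summation formula: let s ∈ ℂ with Re(s) > 2 and z = (z₁,z₂) ∈ ℍ². Then Σ_{x ∈ O} (z₁+σ₁(x))^{−s}·(z₂+σ₂(x))^{−s} = (2π)^{2s} / (e^{πis}·Γ(s)²·D^{1/2}) · Σ_{ξ} (σ₁(ξ)σ₂(ξ))^{s−1} · exp(2πi(σ₁(ξ)z₁ + σ₂(ξ)z₂)), where the sum on the right runs over the totally positive elements ξ of the inverse different 𝔡⁻¹, and both series converge absolutely. -/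
open Complex

noncomputable section

namespace HilbertPaper

variable (F : Type) [Field F] [NumberField F]

/-- Membership in the inverse different `𝔡⁻¹ = {ξ ∈ F : Tr_{F/ℚ}(ξ O) ⊆ ℤ}`. -/
def InInvDiff (ξ : F) : Prop :=
  ∀ a : NumberField.RingOfIntegers F,
    ∃ n : ℤ, Algebra.trace ℚ F (ξ * algebraMap (NumberField.RingOfIntegers F) F a) = (n : ℚ)

/-- The totally positive elements of the inverse different. -/
abbrev InvDiffPos (σ₁ σ₂ : F →+* ℝ) := {ξ : F // InInvDiff F ξ ∧ TotPos F σ₁ σ₂ ξ}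

open MeasureTheory Set in
/-- The integral over `ℝ²` is the sum of the integrals over the unit cube of the integer
translates. -/
theorem integral_eq_tsum_integral_unitCube {f : (Fin 2 → ℝ) → ℂ} (hf : Integrable f) :
    ∫ x, f x = ∑' m : Fin 2 → ℤ,
      ∫ x in {x : Fin 2 → ℝ | ∀ i, x i ∈ Ioc (0 : ℝ) (0 + 1)}, f (x + fun i => (m i : ℝ)) := by
  let Q : (Fin 2 → ℤ) → Set (Fin 2 → ℝ) := fun m => {x | ∀ i, ⌈x i⌉ = m i + 1}
  have hQm : ∀ m, MeasurableSet (Q m) := fun m => by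
    simp only [Q, ofPred_forall]
    exact MeasurableSet.iInter fun i =>
      (Int.measurable_ceil.comp (measurable_pi_apply i)) (measurableSet_singleton (m i + 1))
  have hQd : Pairwise (Function.onFun Disjoint Q) := by
    intro m n hmn
    refine Set.disjoint_left.mpr fun x hx hy => hmn (funext fun i => ?_)
    have h1 := hx i
    have h2 := hy i
    omega
  have hQu : ⋃ m, Q m = univ := by
    refine eq_univ_of_forall fun x => mem_iUnion.mpr ⟨fun i => ⌈x i⌉ - 1, fun i => ?_⟩
    ring
  rw [← setIntegral_univ, ← hQu, integral_iUnion hQm hQd hf.integrableOn]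
  refine tsum_congr fun m => ?_
  have hmp := measurePreserving_add_right (volume : Measure (Fin 2 → ℝ)) (fun i => (m i : ℝ))
  rw [← hmp.setIntegral_preimage_emb (measurableEmbedding_addRight _)]
  congr 2
  ext x
  simp only [Q, mem_preimage, mem_ofPred_eq, Pi.add_apply, Int.ceil_add_intCast, mem_Ioc]
  refine forall_congr' fun i => ?_
  rw [add_comm (m i), add_left_inj, Int.ceil_eq_iff]
  simp

theorem summable_one_add_norm_rpow {c : ℝ} (hc : 2 < c) :
    Summable fun m : Fin 2 → ℤ => (1 + ‖m‖) ^ (-c) := by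
  refine Summable.of_norm_bounded_eventually (EisensteinSeries.summable_one_div_norm_rpow hc) ?_
  filter_upwards [(Set.finite_singleton (0 : Fin 2 → ℤ)).compl_mem_cofinite] with m hm
  have hm' : 0 < ‖m‖ := norm_pos_iff.mpr hm
  rw [Real.norm_of_nonneg (by positivity)]
  exact Real.rpow_le_rpow_of_nonpos hm' (by linarith) (by linarith)

theorem norm_intCast_pi (m : Fin 2 → ℤ) : ‖fun i => (m i : ℝ)‖ = ‖m‖ := by
  simp [Pi.norm_def, nnnorm, ← Int.norm_cast_real]

/-- Decay of translates, uniformly for translations in a bounded set. -/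
theorem norm_translate_le {f : (Fin 2 → ℝ) → ℂ} {c K : ℝ} (hc : 2 < c)
    (hK : ∀ x, ‖f x‖ ≤ K * (1 + ‖x‖) ^ (-c)) {R : ℝ} {x : Fin 2 → ℝ} (hx : ‖x‖ ≤ R)
    (m : Fin 2 → ℤ) :
    ‖f (x + fun i => (m i : ℝ))‖ ≤ K * (1 + R) ^ c * (1 + ‖m‖) ^ (-c) := by
  have hK0 : 0 ≤ K := by simpa using (norm_nonneg _).trans (hK 0)
  have hR : 0 ≤ R := (norm_nonneg x).trans hx
  refine (hK _).trans ?_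
  rw [mul_assoc]
  refine mul_le_mul_of_nonneg_left ?_ hK0
  set y := x + fun i => (m i : ℝ)
  have h1 : ‖m‖ ≤ ‖y‖ + R := by
    rw [← norm_intCast_pi, show (fun i => (m i : ℝ)) = y - x by simp [y]]
    exact (norm_sub_le _ _).trans (by linarith)
  have h2 : 1 + ‖m‖ ≤ (1 + R) * (1 + ‖y‖) := by nlinarith [norm_nonneg y]
  rw [Real.rpow_neg (by positivity), Real.rpow_neg (by positivity), ← div_eq_mul_inv,
    inv_eq_one_div, div_le_div_iff₀ (by positivity) (by positivity), one_mul,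
    ← Real.mul_rpow (by positivity) (by positivity)]
  exact Real.rpow_le_rpow (by positivity) h2 (by linarith)

open MeasureTheory Set in
/-- Poisson summation on `ℤ² ⊆ ℝ²`. -/
theorem tsum_eq_tsum_fourierIntegral {f : (Fin 2 → ℝ) → ℂ} (hf : Continuous f) {c K : ℝ}
    (hc : 2 < c) (hK : ∀ x, ‖f x‖ ≤ K * (1 + ‖x‖) ^ (-c))
    (hsum : Summable fun n : Fin 2 → ℤ =>
      ∫ x : Fin 2 → ℝ, (∏ i, exp (2 * Real.pi * I * (n i * x i))) * f x) :
    ∑' m : Fin 2 → ℤ, f (fun i => (m i : ℝ)) =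
      ∑' n : Fin 2 → ℤ, ∫ x : Fin 2 → ℝ, (∏ i, exp (2 * Real.pi * I * (n i * x i))) * f x := by
  have hInt : Integrable f := by
    refine Integrable.mono' (g := fun x => K * (1 + ‖x‖) ^ (-c)) ?_ hf.aestronglyMeasurable
      (.of_forall hK)
    exact (integrable_one_add_norm (by simpa using hc)).const_mul K
  let P : (Fin 2 → ℝ) → ℂ := fun x => ∑' m : Fin 2 → ℤ, f (x + fun i => (m i : ℝ))
  have hbsum : ∀ R : ℝ, Summable fun m : Fin 2 → ℤ => K * (1 + R) ^ c * (1 + ‖m‖) ^ (-c) :=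
    fun R => (summable_one_add_norm_rpow hc).mul_left _
  have hP : Continuous P := by
    refine continuous_iff_continuousAt.mpr fun x => ?_
    have : ContinuousOn P (Metric.ball 0 (‖x‖ + 1)) := by
      refine continuousOn_tsum (fun m => by fun_prop) (hbsum (‖x‖ + 1)) fun m y hy => ?_
      exact norm_translate_le hc hK (mem_ball_zero_iff.mp hy).le m
    exact this.continuousAt (Metric.isOpen_ball.mem_nhds (by simp))
  let π : (Fin 2 → ℝ) → UnitAddTorus (Fin 2) := fun x i => (x i : UnitAddCircle)
  have hπ : Topology.IsQuotientMap π :=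
    (IsOpenQuotientMap.piMap fun _ : Fin 2 =>
      (QuotientAddGroup.isOpenQuotientMap_mk :
        IsOpenQuotientMap ((↑) : ℝ → UnitAddCircle))).isQuotientMap
  have hper : ∀ (x : Fin 2 → ℝ) (k : Fin 2 → ℤ), P (x + fun i => (k i : ℝ)) = P x := by
    intro x k
    simp only [P]
    rw [← (Equiv.addLeft k).tsum_eq fun m : Fin 2 → ℤ => f (x + fun i => (m i : ℝ))]
    refine tsum_congr fun m => ?_
    congr 1
    ext i
    simp [add_assoc]
  have hfac : Function.FactorsThrough P π := by
    intro x y hxy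
    have : ∀ i, ∃ k : ℤ, x i = y i + k := by
      intro i
      have h := congrFun hxy i
      obtain ⟨k, hk⟩ := (QuotientAddGroup.eq_iff_sub_mem.mp h)
      refine ⟨k, ?_⟩
      simp only [zsmul_eq_mul, mul_one] at hk
      linarith
    choose k hk using this
    rw [← hper y k]
    congr 1
    ext i
    exact hk i
  let Pt : C(UnitAddTorus (Fin 2), ℂ) := Topology.IsQuotientMap.lift
    (f := ⟨π, hπ.continuous⟩) hπ ⟨P, hP⟩ hfac
  have hPt : ∀ x, Pt (π x) = P x := fun x =>
    DFunLike.congr_fun (Topology.IsQuotientMap.lift_comp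
      (f := ⟨π, hπ.continuous⟩) hπ ⟨P, hP⟩ hfac) x
  have hcoeff : ∀ n : Fin 2 → ℤ, UnitAddTorus.mFourierCoeff Pt (-n) =
      ∫ x : Fin 2 → ℝ, (∏ i, exp (2 * Real.pi * I * (n i * x i))) * f x := by
    intro n
    let e : (Fin 2 → ℝ) → ℂ := fun x => ∏ i, exp (2 * Real.pi * I * (n i * x i))
    have he : Continuous e := by fun_prop
    have hen : ∀ x, ‖e x‖ = 1 := by
      intro x
      simp only [e, norm_prod]
      refine Finset.prod_eq_one fun i _ => ?_
      rw [show (2 * Real.pi * I * (n i * x i) : ℂ) = ((2 * Real.pi * (n i * x i) : ℝ) : ℂ) * I by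
        push_cast; ring, norm_exp_ofReal_mul_I]
    have heper : ∀ (x : Fin 2 → ℝ) (k : Fin 2 → ℤ), e (x + fun i => (k i : ℝ)) = e x := by
      intro x k
      refine Finset.prod_congr rfl fun i _ => ?_
      rw [exp_eq_exp_iff_exists_int]
      refine ⟨n i * k i, ?_⟩
      simp only [Pi.add_apply]
      push_cast
      ring
    have hfe : Integrable fun x => e x * f x :=
      hInt.bdd_mul he.aestronglyMeasurable (c := 1) (.of_forall fun x => (hen x).le)
    rw [UnitAddTorus.mFourierCoeff_eq_integral _ _ (fun _ => (0 : ℝ)),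
      integral_eq_tsum_integral_unitCube hfe]
    set S : Set (Fin 2 → ℝ) := {x : Fin 2 → ℝ | ∀ i, x i ∈ Ioc (0 : ℝ) (0 + 1)} with hS
    have hSm : MeasurableSet S := by
      rw [hS, ofPred_forall]
      exact MeasurableSet.iInter fun i => measurable_pi_apply i measurableSet_Ioc
    have hSb : ∀ x ∈ S, ‖x‖ ≤ 1 := fun x hx => by
      refine (pi_norm_le_iff_of_nonneg zero_le_one).mpr fun i => ?_
      have := hx i
      rw [zero_add, mem_Ioc] at this
      rw [Real.norm_of_nonneg this.1.le]
      exact this.2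
    have hSv : volume S < ⊤ :=
      (isBounded_iff_forall_norm_le.mpr ⟨1, hSb⟩).measure_lt_top
    have hbound : ∀ m : Fin 2 → ℤ, ∀ x ∈ S,
        ‖e (x + fun i => (m i : ℝ)) * f (x + fun i => (m i : ℝ))‖ ≤
          K * (1 + 1) ^ c * (1 + ‖m‖) ^ (-c) := fun m x hx => by
      rw [norm_mul, hen, one_mul]
      exact norm_translate_le hc hK (hSb x hx) m
    have hi : ∀ m : Fin 2 → ℤ, Integrable
        (fun x => e (x + fun i => (m i : ℝ)) * f (x + fun i => (m i : ℝ)))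
        (volume.restrict S) := fun m => (hfe.comp_add_right _).integrableOn
    rw [integral_tsum_of_summable_integral_norm hi]
    · refine setIntegral_congr_fun hSm fun x _ => ?_
      simp only [neg_neg, smul_eq_mul]
      simp_rw [heper, tsum_mul_left]
      congr 1
      · simp only [UnitAddTorus.mFourier, ContinuousMap.coe_mk, e]
        refine Finset.prod_congr rfl fun i _ => ?_
        rw [fourier_coe_apply]
        congr 1
        push_cast
        ring
      · exact hPt x
    · refine Summable.of_nonneg_of_le (fun m => integral_nonneg fun x => norm_nonneg _)
        (fun m => ?_) ((hbsum 1).mul_left (volume.real S))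
      refine (setIntegral_mono_on (hi m).norm (integrableOn_const hSv.ne) hSm (hbound m)).trans ?_
      rw [setIntegral_const, smul_eq_mul]
  have hs : Summable (UnitAddTorus.mFourierCoeff Pt) := by
    rw [← (Equiv.neg (Fin 2 → ℤ)).summable_iff]
    exact hsum.congr fun n => (hcoeff n).symm
  have key := (UnitAddTorus.hasSum_mFourier_series_apply_of_summable hs (π 0)).tsum_eq
  rw [hPt] at key
  have h1 : ∀ n : Fin 2 → ℤ, UnitAddTorus.mFourier n (π 0) = 1 := fun n => by
    simp only [UnitAddTorus.mFourier, ContinuousMap.coe_mk, π]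
    exact Finset.prod_eq_one fun i _ => by simp
  simp only [h1, smul_eq_mul, mul_one] at key
  rw [← (Equiv.neg (Fin 2 → ℤ)).tsum_eq] at key
  simp only [Equiv.neg_apply, hcoeff] at key
  rw [key]
  simp [P]

open MeasureTheory Set in
/-- The Gamma integral with a complex scaling parameter. -/
theorem integral_cpow_mul_exp_neg_mul {a r : ℂ} (ha : 0 < a.re) (hr : 0 < r.re) :
    ∫ t : ℝ in Ioi 0, (t : ℂ) ^ (a - 1) * exp (-(r * t)) = r ^ (-a) * Gamma a := by
  let U : Set ℂ := {w | 0 < w.re}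
  have hU : IsOpen U := isOpen_lt continuous_const continuous_re
  have hUc : IsPreconnected U := (convex_halfSpace_re_gt 0).isPreconnected
  have hnorm : ∀ (w : ℂ) (t : ℝ), 0 < t →
      ‖(t : ℂ) ^ (a - 1) * exp (-(w * t))‖ = t ^ (a.re - 1) * Real.exp (-(w.re * t)) := by
    intro w t ht
    rw [norm_mul, norm_cpow_eq_rpow_re_of_pos ht, norm_exp]
    simp
  have hmeas : ∀ w : ℂ, AEStronglyMeasurable
      (fun t : ℝ => (t : ℂ) ^ (a - 1) * exp (-(w * t))) (volume.restrict (Ioi 0)) := by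
    intro w
    refine ContinuousOn.aestronglyMeasurable (fun t ht => ?_) measurableSet_Ioi
    refine ContinuousAt.continuousWithinAt (ContinuousAt.mul ?_ (by fun_prop))
    exact continuousAt_ofReal_cpow_const t _ (Or.inr (ne_of_gt ht))
  have hInt : ∀ q β : ℝ, -1 < q → 0 < β →
      IntegrableOn (fun t : ℝ => t ^ q * Real.exp (-(β * t))) (Ioi 0) := by
    intro q β hq hβ
    simpa using integrableOn_rpow_mul_exp_neg_mul_rpow (p := 1) hq one_pos hβ
  have hdiff : DifferentiableOn ℂ
      (fun w : ℂ => ∫ t : ℝ in Ioi 0, (t : ℂ) ^ (a - 1) * exp (-(w * t))) U := by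
    intro w hw
    have hw : 0 < w.re := hw
    refine DifferentiableAt.differentiableWithinAt (HasDerivAt.differentiableAt
      (hasDerivAt_integral_of_dominated_loc_of_deriv_le (s := {v : ℂ | w.re / 2 < v.re})
      (F' := fun v t => (t : ℂ) ^ (a - 1) * exp (-(v * t)) * (-t))
      (bound := fun t => t ^ a.re * Real.exp (-(w.re / 2 * t)))
      ((isOpen_lt continuous_const continuous_re).mem_nhds (show w.re / 2 < w.re by linarith))
      (.of_forall hmeas) ?_ ?_ ?_ (hInt _ _ (by linarith) (by linarith)) ?_).2)
    · refine Integrable.mono' (hInt (a.re - 1) w.re (by linarith) hw) (hmeas w) ?_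
      filter_upwards [ae_restrict_mem measurableSet_Ioi] with t ht
      exact (hnorm w t ht).le
    · exact (hmeas w).mul (by fun_prop)
    · filter_upwards [ae_restrict_mem measurableSet_Ioi] with t ht v hv
      have ht : 0 < t := ht
      have hv : w.re / 2 < v.re := hv
      rw [norm_mul, hnorm v t ht, norm_neg, norm_real, Real.norm_of_nonneg ht.le, mul_right_comm,
        ← Real.rpow_add_one ht.ne', sub_add_cancel]
      gcongr
    · filter_upwards with t v _
      have h1 : HasDerivAt (fun v : ℂ => -(v * t)) (-t : ℂ) v := by
        simpa using ((hasDerivAt_id v).mul_const (t : ℂ)).fun_neg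
      simpa [mul_assoc] using (h1.cexp.const_mul ((t : ℂ) ^ (a - 1)))
  have hdiff' : DifferentiableOn ℂ (fun w : ℂ => w ^ (-a) * Gamma a) U := by
    intro w hw
    refine DifferentiableAt.differentiableWithinAt ?_
    refine DifferentiableAt.mul_const ?_ _
    exact (differentiableAt_id.cpow_const (Or.inl hw))
  refine (hdiff.analyticOnNhd hU).eqOn_of_preconnected_of_frequently_eq
    (hdiff'.analyticOnNhd hU) hUc (show (1 : ℂ) ∈ U by simp [U]) ?_ hr
  have htend : Filter.Tendsto (fun n : ℕ => (((1 + 1 / ((n : ℝ) + 1)) : ℝ) : ℂ)) Filter.atTop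
      (nhdsWithin 1 {1}ᶜ) := by
    refine tendsto_nhdsWithin_iff.mpr ⟨?_, .of_forall fun n => ?_⟩
    · have := tendsto_one_div_add_atTop_nhds_zero_nat (𝕜 := ℝ)
      have h2 := (continuous_ofReal.tendsto _).comp (this.const_add 1)
      simpa [Function.comp_def] using h2
    · have : (0 : ℝ) < 1 / ((n : ℝ) + 1) := by positivity
      simp only [mem_compl_iff, mem_singleton_iff]
      intro h
      have h' : (1 + 1 / ((n : ℝ) + 1)) = 1 := by exact_mod_cast h
      linarith
  refine htend.frequently (Filter.Frequently.of_forall fun n => ?_)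
  have hn : (0 : ℝ) < 1 + 1 / ((n : ℝ) + 1) := by positivity
  rw [Complex.integral_cpow_mul_exp_neg_mul_Ioi ha hn, one_div, inv_cpow, cpow_neg]
  rw [arg_ofReal_of_nonneg hn.le]
  exact Real.pi_pos.ne

/-- The function `u ↦ u ^ (s - 1) * exp (2πiuz)` on the positive reals, extended by zero. -/
def lipFun (s z : ℂ) (u : ℝ) : ℂ :=
  ((max u 0 : ℝ) : ℂ) ^ (s - 1) * exp (2 * Real.pi * I * (u * z))

theorem lipFun_of_nonpos {s : ℂ} (hs : 1 < s.re) (z : ℂ) {u : ℝ} (hu : u ≤ 0) :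
    lipFun s z u = 0 := by
  have : s - 1 ≠ 0 := fun h => by
    have := congrArg re h
    simp at this
    linarith
  simp [lipFun, max_eq_right hu, zero_cpow this]

theorem lipFun_of_pos (s z : ℂ) {u : ℝ} (hu : 0 < u) :
    lipFun s z u = (u : ℂ) ^ (s - 1) * exp (2 * Real.pi * I * (u * z)) := by
  simp [lipFun, max_eq_left hu.le]

theorem continuous_lipFun {s : ℂ} (hs : 1 < s.re) (z : ℂ) : Continuous (lipFun s z) := by
  refine Continuous.mul ?_ (by fun_prop)
  exact (continuous_ofReal_cpow_const (by simpa using hs)).comp (by fun_prop)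

theorem exists_rpow_le_mul_exp {a β : ℝ} (ha : 0 < a) (hβ : 0 < β) :
    ∃ K, 0 ≤ K ∧ ∀ v : ℝ, 0 < v → v ^ a ≤ K * Real.exp (β * v) := by
  refine ⟨Real.exp (-a - a * Real.log (β / a)), (Real.exp_pos _).le, fun v hv => ?_⟩
  rw [Real.rpow_def_of_pos hv, ← Real.exp_add, Real.exp_le_exp]
  have h1 := Real.log_le_sub_one_of_pos (show 0 < β / a * v by positivity)
  rw [Real.log_mul (by positivity) hv.ne'] at h1
  have h2 := mul_le_mul_of_nonneg_left h1 ha.le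
  have h3 : a * (β / a * v - 1) = β * v - a := by field_simp
  rw [h3] at h2
  linarith

theorem exists_norm_lipFun_le {s z : ℂ} (hs : 1 < s.re) (hz : 0 < z.im) :
    ∃ K, ∀ u : ℝ, ‖lipFun s z u‖ ≤ K * (1 + |u|) ^ (-3 : ℝ) := by
  have hβ : 0 < 2 * Real.pi * z.im := by positivity
  obtain ⟨K, hK0, hK⟩ := exists_rpow_le_mul_exp (show 0 < s.re + 2 by linarith) hβ
  refine ⟨K * Real.exp (2 * Real.pi * z.im), fun u => ?_⟩
  rcases le_or_gt u 0 with hu | hu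
  · rw [lipFun_of_nonpos hs z hu, norm_zero]
    positivity
  · rw [lipFun_of_pos s z hu, norm_mul, norm_cpow_eq_rpow_re_of_pos hu, norm_exp, abs_of_pos hu]
    have hre : (2 * Real.pi * I * (u * z) : ℂ).re = -(2 * Real.pi * z.im * u) := by
      simp
      ring
    rw [hre, sub_re, one_re]
    have h1 : u ^ (s.re - 1) ≤ (1 + u) ^ (s.re - 1) :=
      Real.rpow_le_rpow hu.le (by linarith) (by linarith)
    have h2 : (1 + u) ^ (s.re - 1) = (1 + u) ^ (s.re + 2) * (1 + u) ^ (-3 : ℝ) := by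
      rw [← Real.rpow_add (by linarith)]
      ring_nf
    calc u ^ (s.re - 1) * Real.exp (-(2 * Real.pi * z.im * u))
        ≤ K * Real.exp (2 * Real.pi * z.im * (1 + u)) * (1 + u) ^ (-3 : ℝ) *
            Real.exp (-(2 * Real.pi * z.im * u)) := by
          refine mul_le_mul_of_nonneg_right (h1.trans ?_) (Real.exp_pos _).le
          rw [h2]
          exact mul_le_mul_of_nonneg_right (hK _ (by linarith)) (by positivity)
      _ = K * Real.exp (2 * Real.pi * z.im) * (1 + u) ^ (-3 : ℝ) := by
          rw [mul_add, mul_one, Real.exp_add, Real.exp_neg]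
          field_simp

theorem neg_two_pi_I_mul_cpow {w : ℂ} (hw : 0 < w.im) (s : ℂ) :
    (-(2 * Real.pi * I * w)) ^ (-s) =
      ((2 * Real.pi : ℝ) : ℂ) ^ (-s) * exp (Real.pi * I * s / 2) * w ^ (-s) := by
  have hw0 : w ≠ 0 := fun h => by simp [h] at hw
  have h2π : ((2 * Real.pi : ℝ) : ℂ) ≠ 0 := by exact_mod_cast Real.two_pi_pos.ne'
  have hne : -(2 * Real.pi * I * w) ≠ 0 := by simp [hw0, Real.pi_ne_zero]
  set y : ℂ := log ((2 * Real.pi : ℝ) : ℂ) + log w - Real.pi / 2 * I with hy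
  have hexp : -(2 * Real.pi * I * w) = exp y := by
    rw [hy, exp_sub, exp_add, exp_log h2π, exp_log hw0, exp_pi_div_two_mul_I, div_I]
    push_cast
    ring
  have him : y.im = arg w - Real.pi / 2 := by
    rw [hy, ← ofReal_log Real.two_pi_pos.le]
    simp [log_im]
  have h0 := arg_nonneg_iff.mpr hw.le
  have h1 := arg_le_pi w
  have hlog : log (-(2 * Real.pi * I * w)) = y := by
    rw [hexp, log_exp] <;> rw [him] <;> linarith [Real.pi_pos]
  rw [cpow_def_of_ne_zero hne, cpow_def_of_ne_zero h2π, cpow_def_of_ne_zero hw0, hlog, hy,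
    ← exp_add, ← exp_add]
  congr 1
  ring

/-- The constant relating `lipFun` to its Fourier transform. -/
def lipConst (s : ℂ) : ℂ :=
  Gamma s * ((2 * Real.pi : ℝ) : ℂ) ^ (-s) * exp (Real.pi * I * s / 2)

open MeasureTheory Set in
theorem integral_exp_mul_lipFun {s z : ℂ} (hs : 1 < s.re) (hz : 0 < z.im) (x : ℝ) :
    ∫ u : ℝ, exp (2 * Real.pi * I * (x * u)) * lipFun s z u = lipConst s * (z + x) ^ (-s) := by
  rw [← setIntegral_eq_integral_of_forall_compl_eq_zero (s := Ioi 0)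
    fun u hu => by rw [lipFun_of_nonpos hs z (not_lt.mp hu), mul_zero]]
  have hw : 0 < (z + x).im := by simpa using hz
  have hr : 0 < (-(2 * Real.pi * I * (z + x))).re := by
    have : (-(2 * Real.pi * I * (z + x))).re = 2 * Real.pi * z.im := by simp
    rw [this]
    positivity
  calc ∫ u : ℝ in Ioi 0, exp (2 * Real.pi * I * (x * u)) * lipFun s z u
      = ∫ u : ℝ in Ioi 0, (u : ℂ) ^ (s - 1) * exp (-(-(2 * Real.pi * I * (z + x)) * u)) := by
        refine setIntegral_congr_fun measurableSet_Ioi fun u hu => ?_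
        rw [lipFun_of_pos s z hu, mul_left_comm, ← exp_add]
        congr 2
        ring
    _ = lipConst s * (z + x) ^ (-s) := by
        rw [integral_cpow_mul_exp_neg_mul (by linarith) hr, neg_two_pi_I_mul_cpow hw, lipConst]
        ring

theorem exists_norm_add_cpow_le {z : ℂ} (hz : 0 < z.im) {s : ℂ} (hs : 0 < s.re) :
    ∃ K, ∀ t : ℝ, ‖(z + t) ^ (-s)‖ ≤ K * (1 + |t|) ^ (-s.re) := by
  set C : ℝ := 1 + (1 + ‖z‖) / z.im
  have hC : 0 < C := by positivity
  refine ⟨C ^ s.re * Real.exp (Real.pi * |s.im|), fun t => ?_⟩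
  have him : (z + t).im = z.im := by simp
  have hlow : z.im ≤ ‖z + t‖ := by
    rw [← him]
    exact (le_abs_self _).trans (abs_im_le_norm _)
  have hpos : 0 < ‖z + t‖ := hz.trans_le hlow
  have h1 : |t| ≤ ‖z + t‖ + ‖z‖ := by
    have := norm_sub_le (z + t) z
    simpa using this
  have h2 : 1 + |t| ≤ C * ‖z + t‖ := by
    have : (1 + ‖z‖) ≤ (1 + ‖z‖) / z.im * ‖z + t‖ := by
      rw [div_mul_eq_mul_div, le_div_iff₀ hz]
      exact mul_le_mul_of_nonneg_left hlow (by positivity)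
    simp only [C, add_mul, one_mul]
    linarith
  rw [norm_cpow_of_ne_zero (norm_pos_iff.mp hpos), neg_re, neg_im, div_eq_mul_inv, ← Real.exp_neg,
    mul_right_comm]
  refine mul_le_mul ?_ (Real.exp_le_exp.mpr ?_) (Real.exp_pos _).le (by positivity)
  · rw [Real.rpow_neg hpos.le, Real.rpow_neg (by positivity), ← div_eq_mul_inv,
      inv_eq_one_div, div_le_div_iff₀ (by positivity) (by positivity), one_mul,
      ← Real.mul_rpow hC.le hpos.le]
    exact Real.rpow_le_rpow (by positivity) h2 hs.le
  · rw [mul_neg, neg_neg]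
    refine (le_abs_self _).trans ?_
    rw [abs_mul]
    exact mul_le_mul_of_nonneg_right (abs_arg_le_pi _) (abs_nonneg _)

theorem exists_norm_mulVec_le (M : Matrix (Fin 2) (Fin 2) ℝ) :
    ∃ C, 0 ≤ C ∧ ∀ x : Fin 2 → ℝ, ‖M.mulVec x‖ ≤ C * ‖x‖ :=
  ⟨‖(Matrix.mulVecLin M).toContinuousLinearMap‖, norm_nonneg _, fun x =>
    (Matrix.mulVecLin M).toContinuousLinearMap.le_opNorm x⟩

/-- A product of decaying functions of one variable, composed with an invertible linear map,
decays. -/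
theorem exists_norm_prod_comp_mulVec_le {h : Fin 2 → ℝ → ℂ} {c : ℝ} (hc : 0 < c)
    (hh : ∀ i, ∃ K, ∀ t, ‖h i t‖ ≤ K * (1 + |t|) ^ (-c)) {M N : Matrix (Fin 2) (Fin 2) ℝ}
    (hNM : N * M = 1) :
    ∃ K, ∀ x : Fin 2 → ℝ, ‖∏ i, h i (M.mulVec x i)‖ ≤ K * (1 + ‖x‖) ^ (-c) := by
  choose K hK using hh
  have hK0 : ∀ i, 0 ≤ K i := fun i => by simpa using (norm_nonneg _).trans (hK i 0)
  obtain ⟨C, hC0, hC⟩ := exists_norm_mulVec_le N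
  refine ⟨(∏ i, K i) * (1 + C) ^ c, fun x => ?_⟩
  set u := M.mulVec x with hu
  have hx : ‖x‖ ≤ C * ‖u‖ := by
    have := hC u
    rwa [hu, Matrix.mulVec_mulVec, hNM, Matrix.one_mulVec] at this
  have hle : 1 + ‖u‖ ≤ (1 + |u 0|) * (1 + |u 1|) := by
    have hu' : ‖u‖ ≤ |u 0| + |u 1| := by
      refine (pi_norm_le_iff_of_nonneg (by positivity)).mpr fun i => ?_
      fin_cases i <;> simp
    nlinarith [abs_nonneg (u 0), abs_nonneg (u 1), mul_nonneg (abs_nonneg (u 0)) (abs_nonneg (u 1))]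
  have hfin : 1 + ‖x‖ ≤ (1 + C) * ((1 + |u 0|) * (1 + |u 1|)) := by
    refine le_trans ?_ (mul_le_mul_of_nonneg_left hle (by positivity))
    nlinarith [norm_nonneg u]
  have hprod : ‖∏ i, h i (u i)‖ ≤ (∏ i, K i) * ((1 + |u 0|) * (1 + |u 1|)) ^ (-c) := by
    rw [norm_prod, Real.mul_rpow (by positivity) (by positivity), Fin.prod_univ_two,
      Fin.prod_univ_two, mul_mul_mul_comm]
    exact mul_le_mul (hK 0 _) (hK 1 _) (norm_nonneg _) ((norm_nonneg _).trans (hK 0 _))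
  refine hprod.trans ?_
  rw [mul_assoc]
  refine mul_le_mul_of_nonneg_left ?_ (Finset.prod_nonneg fun i _ => hK0 i)
  rw [Real.rpow_neg (by positivity), Real.rpow_neg (by positivity), ← div_eq_mul_inv,
    inv_eq_one_div, div_le_div_iff₀ (by positivity) (by positivity), one_mul,
    ← Real.mul_rpow (by positivity) (by positivity)]
  exact Real.rpow_le_rpow (by positivity) hfin hc.le

theorem summable_of_norm_le_one_add_norm_rpow {f : (Fin 2 → ℝ) → ℂ} {c : ℝ} (hc : 2 < c)
    (hf : ∃ K, ∀ x, ‖f x‖ ≤ K * (1 + ‖x‖) ^ (-c)) :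
    Summable fun m : Fin 2 → ℤ => f (fun i => (m i : ℝ)) := by
  obtain ⟨K, hK⟩ := hf
  refine Summable.of_norm_bounded ((summable_one_add_norm_rpow hc).mul_left K) fun m => ?_
  rw [← norm_intCast_pi]
  exact hK _

section Lattice

variable {B : Matrix (Fin 2) (Fin 2) ℝ} {s : ℂ} {z : Fin 2 → ℂ}

theorem summable_prod_add_mulVec_cpow (hB : B.det ≠ 0) (hs : 2 < s.re) (hz : ∀ i, 0 < (z i).im) :
    Summable fun n : Fin 2 → ℤ =>
      ∏ i, (z i + (B.mulVec (fun j => (n j : ℝ)) i : ℂ)) ^ (-s) :=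
  summable_of_norm_le_one_add_norm_rpow
    (f := fun x => ∏ i, (z i + (B.mulVec x i : ℂ)) ^ (-s)) hs
    (exists_norm_prod_comp_mulVec_le (h := fun i t => (z i + (t : ℂ)) ^ (-s)) (by linarith)
      (fun i => exists_norm_add_cpow_le (hz i) (by linarith))
      (Matrix.nonsing_inv_mul B hB.isUnit))

theorem exists_norm_prod_lipFun_le (hB : B.det ≠ 0) (hs : 2 < s.re) (hz : ∀ i, 0 < (z i).im) :
    ∃ K, ∀ x : Fin 2 → ℝ,
      ‖∏ i, lipFun s (z i) (B.transpose⁻¹.mulVec x i)‖ ≤ K * (1 + ‖x‖) ^ (-3 : ℝ) :=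
  exists_norm_prod_comp_mulVec_le (h := fun i => lipFun s (z i)) (by norm_num)
    (fun i => exists_norm_lipFun_le (by linarith) (hz i))
    (Matrix.mul_nonsing_inv B.transpose (by simpa using hB))

theorem summable_prod_lipFun (hB : B.det ≠ 0) (hs : 2 < s.re) (hz : ∀ i, 0 < (z i).im) :
    Summable fun m : Fin 2 → ℤ =>
      ∏ i, lipFun s (z i) (B.transpose⁻¹.mulVec (fun j => (m j : ℝ)) i) :=
  summable_of_norm_le_one_add_norm_rpow
    (f := fun x => ∏ i, lipFun s (z i) (B.transpose⁻¹.mulVec x i)) (by norm_num)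
    (exists_norm_prod_lipFun_le hB hs hz)

open MeasureTheory in
theorem integral_comp_mulVec {M : Matrix (Fin 2) (Fin 2) ℝ} (hM : M.det ≠ 0)
    {f : (Fin 2 → ℝ) → ℂ} (hf : Continuous f) :
    ∫ x, f (M.mulVec x) = (|M.det⁻¹| : ℝ) * ∫ u, f u := by
  have hcont : Continuous (Matrix.toLin' M) := LinearMap.continuous_of_finiteDimensional _
  have h := integral_map (μ := volume) hcont.aemeasurable hf.aestronglyMeasurable
  rw [Real.map_matrix_volume_pi_eq_smul_volume_pi hM, integral_smul_measure,
    ENNReal.toReal_ofReal (abs_nonneg _), real_smul] at h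
  exact h.symm

open MeasureTheory in
theorem integral_prod_exp_mul_prod_lipFun (hB : B.det ≠ 0) (hs : 2 < s.re)
    (hz : ∀ i, 0 < (z i).im) (n : Fin 2 → ℤ) :
    ∫ x : Fin 2 → ℝ, (∏ i, exp (2 * Real.pi * I * (n i * x i))) *
        ∏ i, lipFun s (z i) (B.transpose⁻¹.mulVec x i) =
      (|B.det| : ℝ) * (lipConst s ^ 2 *
        ∏ i, (z i + (B.mulVec (fun j => (n j : ℝ)) i : ℂ)) ^ (-s)) := by
  set v := B.mulVec (fun j => (n j : ℝ)) with hv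
  let F : Fin 2 → ℝ → ℂ := fun i t => exp (2 * Real.pi * I * (v i * t)) * lipFun s (z i) t
  have hdet : B.transpose⁻¹.det = B.det⁻¹ := by
    rw [Matrix.det_nonsing_inv, Matrix.det_transpose, Ring.inverse_eq_inv']
  have hF : ∀ x : Fin 2 → ℝ, (∏ i, exp (2 * Real.pi * I * (n i * x i))) *
      ∏ i, lipFun s (z i) (B.transpose⁻¹.mulVec x i) =
        ∏ i, F i (B.transpose⁻¹.mulVec x i) := by
    intro x
    set u := B.transpose⁻¹.mulVec x with hu
    have hx : x = B.transpose.mulVec u := by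
      rw [hu, Matrix.mulVec_mulVec, Matrix.mul_nonsing_inv _ (by simpa using hB),
        Matrix.one_mulVec]
    simp only [F, Finset.prod_mul_distrib]
    congr 1
    simp only [Fin.prod_univ_two, ← exp_add]
    congr 1
    rw [hx, hv]
    simp only [Matrix.mulVec, dotProduct, Fin.sum_univ_two, Matrix.transpose_apply]
    push_cast
    ring
  have hcont : Continuous fun u : Fin 2 → ℝ => ∏ i, F i (u i) := by
    refine continuous_finsetProd _ fun i _ => ?_
    have := (continuous_lipFun (show 1 < s.re by linarith) (z i)).comp
      (continuous_apply (A := fun _ : Fin 2 => ℝ) i)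
    exact Continuous.mul (by fun_prop) this
  simp_rw [hF]
  rw [integral_comp_mulVec (by rw [hdet]; exact inv_ne_zero hB) hcont, hdet, inv_inv,
    integral_fintype_prod_volume_eq_prod]
  congr 1
  simp only [F, Fin.prod_univ_two]
  rw [integral_exp_mul_lipFun (by linarith) (hz 0), integral_exp_mul_lipFun (by linarith) (hz 1)]
  ring

/-- The Lipschitz summation formula for the lattice `B ℤ²` and its dual lattice. -/
theorem tsum_prod_lipFun (hB : B.det ≠ 0) (hs : 2 < s.re) (hz : ∀ i, 0 < (z i).im) :
    ∑' m : Fin 2 → ℤ, ∏ i, lipFun s (z i) (B.transpose⁻¹.mulVec (fun j => (m j : ℝ)) i) =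
      (|B.det| : ℝ) * (lipConst s ^ 2 *
        ∑' n : Fin 2 → ℤ, ∏ i, (z i + (B.mulVec (fun j => (n j : ℝ)) i : ℂ)) ^ (-s)) := by
  obtain ⟨K, hK⟩ := exists_norm_prod_lipFun_le hB hs hz
  have hcont : Continuous fun x : Fin 2 → ℝ =>
      ∏ i, lipFun s (z i) (B.transpose⁻¹.mulVec x i) := by
    refine continuous_finsetProd _ fun i _ => ?_
    have hlin : Continuous fun x : Fin 2 → ℝ => B.transpose⁻¹.mulVec x i := by
      simp only [Matrix.mulVec, dotProduct]
      fun_prop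
    exact (continuous_lipFun (by linarith) (z i)).comp hlin
  rw [tsum_eq_tsum_fourierIntegral hcont (show (2 : ℝ) < 3 by norm_num) hK]
  · simp_rw [integral_prod_exp_mul_prod_lipFun hB hs hz, tsum_mul_left]
  · simp_rw [integral_prod_exp_mul_prod_lipFun hB hs hz]
    exact ((summable_prod_add_mulVec_cpow hB hs hz).mul_left _).mul_left _

end Lattice

section RealQuadratic

variable {F} {σ₁ σ₂ : F →+* ℝ}

theorem trace_eq_add_of_finrank_eq_two (hdeg : Module.finrank ℚ F = 2) (hne : σ₁ ≠ σ₂) (x : F) :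
    ((Algebra.trace ℚ F x : ℚ) : ℝ) = σ₁ x + σ₂ x := by
  classical
  let τ : (F →+* ℝ) → (F →ₐ[ℚ] ℂ) := fun σ => (ofRealHom.comp σ).toRatAlgHom
  have hτ : τ σ₁ ≠ τ σ₂ := fun h => hne <| RingHom.ext fun y =>
    ofReal_injective (DFunLike.congr_fun h y : ((σ₁ y : ℝ) : ℂ) = (σ₂ y : ℝ))
  have hcard : Fintype.card (F →ₐ[ℚ] ℂ) = 2 := by rw [AlgHom.card, hdeg]
  have huniv : ({τ σ₁, τ σ₂} : Finset (F →ₐ[ℚ] ℂ)) = Finset.univ :=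
    Finset.eq_univ_of_card _ (by rw [Finset.card_pair hτ, hcard])
  have h := trace_eq_sum_embeddings (K := ℚ) (L := F) ℂ (x := x)
  rw [← huniv, Finset.sum_pair hτ] at h
  have h' : (((Algebra.trace ℚ F x : ℚ) : ℝ) : ℂ) = ((σ₁ x + σ₂ x : ℝ) : ℂ) := by
    have hval : ∀ σ : F →+* ℝ, τ σ x = ((σ x : ℝ) : ℂ) := fun _ => rfl
    rw [hval, hval] at h
    rw [ofReal_add]
    simpa using h
  exact_mod_cast h'

/-- The matrix of real embeddings of a basis of the ring of integers. -/
def embMatrix (σ₁ σ₂ : F →+* ℝ) (b : Module.Basis (Fin 2) ℤ (NumberField.RingOfIntegers F)) :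
    Matrix (Fin 2) (Fin 2) ℝ :=
  Matrix.of fun i j => ![emb F σ₁, emb F σ₂] i (b j)

variable (b : Module.Basis (Fin 2) ℤ (NumberField.RingOfIntegers F))

theorem discr_eq_det_embMatrix_sq (hdeg : Module.finrank ℚ F = 2) (hne : σ₁ ≠ σ₂) :
    (NumberField.discr F : ℝ) = (embMatrix σ₁ σ₂ b).det ^ 2 := by
  have htr : ∀ x y : NumberField.RingOfIntegers F,
      ((Algebra.trace ℤ (NumberField.RingOfIntegers F) (x * y) : ℤ) : ℝ) =
        emb F σ₁ x * emb F σ₁ y + emb F σ₂ x * emb F σ₂ y := by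
    intro x y
    have h := Algebra.coe_trace_int (K := F) (x * y)
    have h2 := trace_eq_add_of_finrank_eq_two hdeg hne ((x * y : NumberField.RingOfIntegers F) : F)
    rw [← h] at h2
    simpa [emb] using h2
  have hmat : (Algebra.traceMatrix ℤ b).map (Int.castRingHom ℝ) =
      (embMatrix σ₁ σ₂ b).transpose * embMatrix σ₁ σ₂ b := by
    ext i j
    simp [Matrix.mul_apply, Fin.sum_univ_two, embMatrix, Algebra.traceMatrix_apply,
      Algebra.traceForm_apply, htr]
  rw [← NumberField.discr_eq_discr F b, Algebra.discr_def, sq]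
  conv_rhs => rw [← Matrix.det_transpose (embMatrix σ₁ σ₂ b)]
  rw [Matrix.det_transpose]
  nth_rewrite 1 [← Matrix.det_transpose (embMatrix σ₁ σ₂ b)]
  rw [← Matrix.det_mul, ← hmat]
  exact (Int.castRingHom ℝ).map_det _

theorem det_embMatrix_ne_zero (hdeg : Module.finrank ℚ F = 2) (hne : σ₁ ≠ σ₂) :
    (embMatrix σ₁ σ₂ b).det ≠ 0 := by
  intro h
  have := discr_eq_det_embMatrix_sq b hdeg hne
  rw [h] at this
  exact NumberField.discr_ne_zero F (by simpa using this)

theorem embMatrix_mulVec_equivFun (x : NumberField.RingOfIntegers F) :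
    (embMatrix σ₁ σ₂ b).mulVec (fun j => (b.equivFun x j : ℝ)) = ![emb F σ₁ x, emb F σ₂ x] := by
  have key : ∀ τ : NumberField.RingOfIntegers F →+* ℝ,
      τ x = τ (b 0) * b.equivFun x 0 + τ (b 1) * b.equivFun x 1 := by
    intro τ
    conv_lhs => rw [← b.sum_equivFun x]
    simp only [Fin.sum_univ_two, map_add, zsmul_eq_mul, map_mul, map_intCast]
    ring
  ext i
  fin_cases i
  · simpa [Matrix.mulVec, dotProduct, Fin.sum_univ_two, embMatrix] using (key (emb F σ₁)).symm
  · simpa [Matrix.mulVec, dotProduct, Fin.sum_univ_two, embMatrix] using (key (emb F σ₂)).symm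

theorem embMatrix_transpose_mulVec (hdeg : Module.finrank ℚ F = 2) (hne : σ₁ ≠ σ₂) (ξ : F) :
    (embMatrix σ₁ σ₂ b).transpose.mulVec ![σ₁ ξ, σ₂ ξ] =
      fun j => ((Algebra.trace ℚ F (ξ * algebraMap (NumberField.RingOfIntegers F) F (b j)) : ℚ)
        : ℝ) := by
  ext j
  rw [trace_eq_add_of_finrank_eq_two hdeg hne]
  simp [Matrix.mulVec, dotProduct, Fin.sum_univ_two, embMatrix, emb]
  ring

/-- Coordinates of elements of the inverse different with respect to the trace dual of `b`. -/
theorem eq_inv_mulVec_iff (hdeg : Module.finrank ℚ F = 2) (hne : σ₁ ≠ σ₂) (ξ : F)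
    (m : Fin 2 → ℤ) :
    (embMatrix σ₁ σ₂ b).transpose⁻¹.mulVec (fun j => (m j : ℝ)) = ![σ₁ ξ, σ₂ ξ] ↔
      ∀ j, Algebra.trace ℚ F (ξ * algebraMap (NumberField.RingOfIntegers F) F (b j)) = m j := by
  have hu : IsUnit (embMatrix σ₁ σ₂ b).transpose.det := by
    simpa using det_embMatrix_ne_zero b hdeg hne
  have h := embMatrix_transpose_mulVec b hdeg hne ξ
  constructor
  · intro h2 j
    rw [← h2, Matrix.mulVec_mulVec, Matrix.mul_nonsing_inv _ hu, Matrix.one_mulVec] at h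
    have := congrFun h j
    exact_mod_cast this.symm
  · intro h2
    have h3 : (fun j => (m j : ℝ)) = (embMatrix σ₁ σ₂ b).transpose.mulVec ![σ₁ ξ, σ₂ ξ] := by
      rw [h]
      ext j
      rw [h2 j]
      simp
    rw [h3, Matrix.mulVec_mulVec, Matrix.nonsing_inv_mul _ hu, Matrix.one_mulVec]

theorem exists_inInvDiff_trace_eq (m : Fin 2 → ℤ) :
    ∃ ξ : F, InInvDiff F ξ ∧
      ∀ j, Algebra.trace ℚ F (ξ * algebraMap (NumberField.RingOfIntegers F) F (b j)) = m j := by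
  let bQ := b.localizationLocalization ℚ (nonZeroDivisors ℤ) F
  have hbQ : ∀ j, bQ j = algebraMap (NumberField.RingOfIntegers F) F (b j) := fun j =>
    b.localizationLocalization_apply ℚ (nonZeroDivisors ℤ) F j
  let ξ : F := bQ.traceDual.equivFun.symm fun j => (m j : ℚ)
  have hξ : ∀ j, Algebra.trace ℚ F (ξ * algebraMap (NumberField.RingOfIntegers F) F (b j)) =
      m j := by
    intro j
    have h := bQ.traceDual_repr_apply ξ j
    rw [Algebra.traceForm_apply, hbQ, ← Module.Basis.equivFun_apply] at h
    rw [← h]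
    exact congrFun (bQ.traceDual.equivFun.apply_symm_apply _) j
  refine ⟨ξ, fun a => ⟨b.equivFun a 0 * m 0 + b.equivFun a 1 * m 1, ?_⟩, hξ⟩
  conv_lhs => rw [← b.sum_equivFun a]
  have hsm : ∀ (k : ℤ) (y : F), ξ * ((k : F) * y) = (k : ℚ) • (ξ * y) := fun k y => by
    rw [Algebra.smul_def]
    simp
    ring
  simp only [Fin.sum_univ_two, map_add, zsmul_eq_mul, map_mul, map_intCast, mul_add, hsm, map_smul,
    hξ, smul_eq_mul]
  push_cast
  ring

end RealQuadratic

/-- multi-variable Lipschitz summation formula. For `Re s > 2` and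
`z = (z₁,z₂) ∈ ℍ²`,
`Σ_{x ∈ O} (z₁+σ₁(x))^{-s} (z₂+σ₂(x))^{-s}
  = (2π)^{2s} / (e^{πis} Γ(s)² D^{1/2}) · Σ_{ξ ∈ (𝔡⁻¹)₊} N(ξ)^{s-1} e^{2πi(σ₁(ξ)z₁+σ₂(ξ)z₂)}`,
both series converging absolutely. -/
theorem statement3 (σ₁ σ₂ : F →+* ℝ) (hF : RealQuadNarrowOne F σ₁ σ₂)
    (s : ℂ) (hs : 2 < s.re) (z₁ z₂ : ℂ) (hz₁ : 0 < z₁.im) (hz₂ : 0 < z₂.im) :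
    Summable (fun x : NumberField.RingOfIntegers F =>
      (z₁ + ((emb F σ₁ x : ℝ) : ℂ)) ^ (-s) * (z₂ + ((emb F σ₂ x : ℝ) : ℂ)) ^ (-s)) ∧
    Summable (fun ξ : InvDiffPos F σ₁ σ₂ =>
      ((σ₁ ξ.1 * σ₂ ξ.1 : ℝ) : ℂ) ^ (s - 1) *
        Complex.exp (2 * Real.pi * Complex.I *
          (((σ₁ ξ.1 : ℝ) : ℂ) * z₁ + ((σ₂ ξ.1 : ℝ) : ℂ) * z₂))) ∧
    (∑' x : NumberField.RingOfIntegers F,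
        (z₁ + ((emb F σ₁ x : ℝ) : ℂ)) ^ (-s) * (z₂ + ((emb F σ₂ x : ℝ) : ℂ)) ^ (-s))
      = ((2 * Real.pi : ℝ) : ℂ) ^ (2 * s) /
          (Complex.exp (Real.pi * Complex.I * s) * Complex.Gamma s ^ 2 *
            ((Real.sqrt (NumberField.discr F : ℝ) : ℝ) : ℂ)) *
        ∑' ξ : InvDiffPos F σ₁ σ₂,
          ((σ₁ ξ.1 * σ₂ ξ.1 : ℝ) : ℂ) ^ (s - 1) *
            Complex.exp (2 * Real.pi * Complex.I *
              (((σ₁ ξ.1 : ℝ) : ℂ) * z₁ + ((σ₂ ξ.1 : ℝ) : ℂ) * z₂)) := by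
  obtain ⟨hdeg, hne, -⟩ := hF
  let b : Module.Basis (Fin 2) ℤ (NumberField.RingOfIntegers F) :=
    Module.finBasisOfFinrankEq ℤ _ (by rw [NumberField.RingOfIntegers.rank, hdeg])
  set B := embMatrix σ₁ σ₂ b with hBdef
  have hB : B.det ≠ 0 := det_embMatrix_ne_zero b hdeg hne
  have hz : ∀ i, 0 < ((![z₁, z₂] : Fin 2 → ℂ) i).im := by
    intro i
    fin_cases i <;> simpa
  have hleft : (fun x : NumberField.RingOfIntegers F =>
      (z₁ + ((emb F σ₁ x : ℝ) : ℂ)) ^ (-s) * (z₂ + ((emb F σ₂ x : ℝ) : ℂ)) ^ (-s)) =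
      (fun n : Fin 2 → ℤ => ∏ i, ((![z₁, z₂] : Fin 2 → ℂ) i +
        (B.mulVec (fun j => (n j : ℝ)) i : ℂ)) ^ (-s)) ∘ b.equivFun.toEquiv := by
    funext x
    have h := embMatrix_mulVec_equivFun (σ₁ := σ₁) (σ₂ := σ₂) b x
    simp only [Function.comp_apply, LinearEquiv.coe_toEquiv, hBdef, h, Fin.prod_univ_two]
    rfl
  set G : (Fin 2 → ℤ) → ℂ := fun m => ∏ i, lipFun s ((![z₁, z₂] : Fin 2 → ℂ) i)
    (B.transpose⁻¹.mulVec (fun j => (m j : ℝ)) i) with hG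
  choose φ hφ using fun (ξ : InvDiffPos F σ₁ σ₂) (j : Fin 2) => ξ.2.1 (b j)
  have hvec : ∀ ξ, B.transpose⁻¹.mulVec (fun j => (φ ξ j : ℝ)) = ![σ₁ ξ.1, σ₂ ξ.1] := fun ξ =>
    (eq_inv_mulVec_iff b hdeg hne ξ.1 (φ ξ)).mpr (hφ ξ)
  have hinj : Function.Injective φ := by
    intro ξ η h
    have h1 := hvec ξ
    rw [h, hvec η] at h1
    exact Subtype.ext (σ₁.injective (congrFun h1 0).symm)
  have hright : (fun ξ : InvDiffPos F σ₁ σ₂ =>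
      ((σ₁ ξ.1 * σ₂ ξ.1 : ℝ) : ℂ) ^ (s - 1) *
        Complex.exp (2 * Real.pi * Complex.I *
          (((σ₁ ξ.1 : ℝ) : ℂ) * z₁ + ((σ₂ ξ.1 : ℝ) : ℂ) * z₂))) = G ∘ φ := by
    funext ξ
    obtain ⟨h₁, h₂⟩ := ξ.2.2
    simp only [Function.comp_apply, hG, hvec, Fin.prod_univ_two, Matrix.cons_val_zero,
      Matrix.cons_val_one, lipFun_of_pos _ _ h₁, lipFun_of_pos _ _ h₂]
    rw [ofReal_mul, mul_cpow_ofReal_nonneg h₁.le h₂.le, mul_mul_mul_comm, ← exp_add, ← mul_add]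
  have hsupp : Function.support G ⊆ Set.range φ := by
    intro m hm
    obtain ⟨ξ, hξ, htr⟩ := exists_inInvDiff_trace_eq b m
    have hv := (eq_inv_mulVec_iff b hdeg hne ξ m).mpr htr
    have hpos : ∀ i, 0 < B.transpose⁻¹.mulVec (fun j => (m j : ℝ)) i := by
      intro i
      by_contra! hi
      exact hm (Finset.prod_eq_zero (Finset.mem_univ i)
        (lipFun_of_nonpos (by linarith) _ hi))
    rw [hBdef, hv] at hpos
    refine ⟨⟨ξ, hξ, hpos 0, hpos 1⟩, funext fun j => ?_⟩
    have h := hφ ⟨ξ, hξ, hpos 0, hpos 1⟩ j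
    rw [htr j] at h
    exact_mod_cast h.symm
  refine ⟨?_, ?_, ?_⟩
  · rw [hleft, Equiv.summable_iff]
    exact summable_prod_add_mulVec_cpow hB hs hz
  · rw [hright]
    exact (summable_prod_lipFun hB hs hz).comp_injective hinj
  · rw [hleft, hright]
    simp only [Function.comp_def]
    rw [hinj.tsum_eq hsupp, Equiv.tsum_eq b.equivFun.toEquiv (fun n : Fin 2 → ℤ =>
        ∏ i, ((![z₁, z₂] : Fin 2 → ℂ) i + (B.mulVec (fun j => (n j : ℝ)) i : ℂ)) ^ (-s)),
      tsum_prod_lipFun hB hs hz, discr_eq_det_embMatrix_sq b hdeg hne, Real.sqrt_sq_eq_abs]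
    have hdet : ((|B.det| : ℝ) : ℂ) ≠ 0 := by exact_mod_cast abs_ne_zero.mpr hB
    have hΓ : Gamma s ≠ 0 := Gamma_ne_zero_of_re_pos (by linarith)
    have hpi : ((2 * Real.pi : ℝ) : ℂ) ≠ 0 := by exact_mod_cast Real.two_pi_pos.ne'
    have hconst : ((2 * Real.pi : ℝ) : ℂ) ^ (2 * s) * lipConst s ^ 2 =
        exp (Real.pi * I * s) * Gamma s ^ 2 := by
      have hpow : ((2 * Real.pi : ℝ) : ℂ) ^ (2 * s) * (((2 * Real.pi : ℝ) : ℂ) ^ (-s)) ^ 2 = 1 := by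
        rw [sq, ← cpow_add _ _ hpi, ← cpow_add _ _ hpi]
        ring_nf
        simp
      have hexp : exp (Real.pi * I * s / 2) ^ 2 = exp (Real.pi * I * s) := by
        rw [← exp_nat_mul]
        congr 1
        push_cast
        ring
      rw [lipConst, mul_pow, mul_pow, hexp, ← one_mul (exp _ * _), ← hpow]
      ring
    rw [← hBdef, div_mul_eq_mul_div, eq_div_iff (by
      exact mul_ne_zero (mul_ne_zero (exp_ne_zero _) (pow_ne_zero 2 hΓ)) hdet), ← hconst]
    ring

end HilbertPaper
end
end
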